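/- If p is a prime number with p ≡ 9 (mod 16), then the class number of the field ℚ(p^{1/4}) (the number field obtained by adjoining to ℚ a root of x⁴ − p) is congruent to 2 modulo 4. -/

import Mathlib

set_option maxHeartbeats 1000000
set_option synthInstance.maxHeartbeats 400000

open NumberField

/-- An involution `σ` of an `A`-algebra `B` whose fixed points all come from `A`. -/
structure FixedInvolution (A B : Type*) [CommRing A] [CommRing B] [Algebra A B] where
  /-- the underlying automorphism -/
  σ : B ≃+* B
  apply_apply : ∀ x, σ (σ x) = x
  apply_algebraMap : ∀ a, σ (algebraMap A B a) = algebraMap A B a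
  exists_of_fixed : ∀ x, σ x = x → ∃ a, algebraMap A B a = x

namespace FixedInvolution

section Basic

variable {A B : Type*} [CommRing A] [CommRing B] [Algebra A B]

theorem exists_trace (τ : FixedInvolution A B) (x : B) : ∃ a, algebraMap A B a = x + τ.σ x :=
  τ.exists_of_fixed _ (by rw [map_add, τ.apply_apply, add_comm])

theorem exists_norm (τ : FixedInvolution A B) (x : B) : ∃ a, algebraMap A B a = x * τ.σ x :=
  τ.exists_of_fixed _ (by rw [map_mul, τ.apply_apply, mul_comm])

theorem apply_mem_map (τ : FixedInvolution A B) {J : Ideal A} {x : B}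
    (hx : x ∈ J.map (algebraMap A B)) : τ.σ x ∈ J.map (algebraMap A B) := by
  have h : (J.map (algebraMap A B)).map (τ.σ : B →+* B) = J.map (algebraMap A B) := by
    rw [Ideal.map_map]
    congr 1
    ext a
    exact τ.apply_algebraMap a
  rw [← h]
  exact Ideal.mem_map_of_mem (τ.σ : B →+* B) hx

end Basic

section DedekindBase

variable {A B : Type*} [CommRing A] [IsDedekindDomain A] [CommRing B] [IsDedekindDomain B]
  [Algebra A B] (τ : FixedInvolution A B)

/-- If `σ` acts nontrivially modulo `P`, then `P` is unramified over `A`. -/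
theorem not_sq_dvd_map {p : Ideal A} [p.IsPrime] (hp : p ≠ ⊥)
    (hinj : Function.Injective (algebraMap A B)) {P : Ideal B} [P.IsPrime] {y : B}
    (hy : y - τ.σ y ∉ P) : ¬ P ^ 2 ∣ p.map (algebraMap A B) := by
  rintro ⟨J, hJ⟩
  set I := p.map (algebraMap A B) with hI
  have hI0 : I ≠ ⊥ := by rwa [hI, Ne, Ideal.map_eq_bot_iff_of_injective hinj]
  have hIP : I ≤ P := by
    rw [hJ, pow_two, mul_assoc]
    exact Ideal.mul_le_left
  have hcomap : P.comap (algebraMap A B) = p := by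
    have hm : p.IsMaximal := Ideal.IsPrime.isMaximal inferInstance hp
    refine (hm.eq_of_le (Ideal.comap_ne_top _ (Ideal.IsPrime.ne_top inferInstance)) ?_).symm
    rwa [← Ideal.map_le_iff_le_comap]
  have key : ∀ x ∈ P * J, x + τ.σ x ∈ I := by
    intro x hx
    have hx2 : x ^ 2 ∈ I := by
      have h1 : x ^ 2 ∈ (P * J) ^ 2 := Ideal.pow_mem_pow hx 2
      have h2 : (P * J) ^ 2 ≤ I := by
        rw [hJ, mul_pow, pow_two J, ← mul_assoc (P ^ 2)]
        exact Ideal.mul_le_left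
      exact h2 h1
    have hxr : x ∈ I.radical := ⟨2, hx2⟩
    have hsr : τ.σ x ∈ I.radical := ⟨2, by rw [← map_pow]; exact τ.apply_mem_map hx2⟩
    obtain ⟨n, hn⟩ : x + τ.σ x ∈ I.radical := I.radical.add_mem hxr hsr
    obtain ⟨a, ha⟩ := τ.exists_trace x
    rw [← ha]
    refine Ideal.mem_map_of_mem _ ?_
    rw [← hcomap, Ideal.mem_comap, ha]
    exact Ideal.IsPrime.mem_of_pow_mem inferInstance n (hIP hn)
  have hle : (P * J) * Ideal.span {y - τ.σ y} ≤ (P * J) * P := by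
    have : (P * J) * P = I := by rw [hJ]; ring
    rw [this, Ideal.mul_le]
    intro x hx z hz
    obtain ⟨c, rfl⟩ := Ideal.mem_span_singleton'.mp hz
    have h1 := key x hx
    have h2 := key (x * y) (Ideal.mul_mem_right _ _ hx)
    have h3 : x * (c * (y - τ.σ y)) =
        c * ((x * y + τ.σ (x * y)) - (x + τ.σ x) * τ.σ y) := by
      rw [map_mul]; ring
    rw [h3]
    exact I.mul_mem_left _ (I.sub_mem h2 (I.mul_mem_right _ h1))
  have hPJ : P * J ≠ 0 := by
    rintro h
    apply hI0
    rw [hJ, pow_two, mul_assoc, h, mul_zero]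
    rfl
  rw [← Ideal.dvd_iff_le] at hle
  have := (mul_dvd_mul_iff_left hPJ).mp hle
  exact hy ((Ideal.dvd_span_singleton).mp this)

/-- Multiplicative induction for the ideals whose square is extended from `A`. -/
theorem induction_of_sq_eq_map (hinj : Function.Injective (algebraMap A B))
    {C : Ideal B → Prop}
    (hmap : ∀ J : Ideal A, C (J.map (algebraMap A B)))
    (hmul : ∀ I J, C I → C J → C (I * J))
    (hcase : ∀ p : Ideal A, p.IsPrime → p ≠ ⊥ →
      (∃ P, C P ∧ p.map (algebraMap A B) = P ^ 2) ∨
      ((∃ P : Ideal B, P.IsPrime ∧ p.map (algebraMap A B) ≤ P) ∧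
        ∀ P : Ideal B, P.IsPrime → ¬ P ^ 2 ∣ p.map (algebraMap A B)))
    (D : Ideal A) (hD : D ≠ ⊥) (I : Ideal B) (h : I ^ 2 = D.map (algebraMap A B)) : C I := by
  induction D using (wellFounded_dvdNotUnit (α := Ideal A)).induction generalizing I with
  | _ D ih =>
  by_cases hu : IsUnit D
  · have hD1 : D = 1 := by rwa [Ideal.isUnit_iff, ← Ideal.one_eq_top] at hu
    have hI1 : I = 1 := by
      rw [hD1, Ideal.one_eq_top, Ideal.map_top, ← Ideal.one_eq_top] at h
      rw [Ideal.one_eq_top, ← Ideal.isUnit_iff]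
      exact IsUnit.of_pow_eq_one h two_ne_zero
    have := hmap ⊤
    rwa [Ideal.map_top, ← Ideal.one_eq_top, ← hI1] at this
  obtain ⟨p, hp, E, rfl⟩ := WfDvdMonoid.exists_irreducible_factor hu hD
  have hpp : p.IsPrime := Ideal.isPrime_of_prime hp.prime
  have hp0 : p ≠ ⊥ := hp.ne_zero
  have hE0 : E ≠ ⊥ := right_ne_zero_of_mul hD
  have hmp0 : p.map (algebraMap A B) ≠ 0 := by
    rwa [Ne, Ideal.zero_eq_bot, Ideal.map_eq_bot_iff_of_injective hinj]
  have hlt : DvdNotUnit E (p * E) := ⟨hE0, p, hp.not_isUnit, mul_comm _ _⟩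
  rw [Ideal.map_mul] at h
  rcases hcase p hpp hp0 with ⟨P, hCP, hP⟩ | ⟨⟨P, hP, hpP⟩, hsq⟩
  · rw [hP] at h
    have hdvd : P ∣ I :=
      (UniqueFactorizationMonoid.pow_dvd_pow_iff_dvd two_ne_zero).mp ⟨_, h.trans rfl⟩
    obtain ⟨I', rfl⟩ := hdvd
    refine hmul _ _ hCP (ih E hlt hE0 I' ?_)
    rw [mul_pow] at h
    exact mul_left_cancel₀ (hP ▸ hmp0) h
  · have hsqf : Squarefree (p.map (algebraMap A B)) := by
      rw [squarefree_iff_irreducible_sq_not_dvd_of_ne_zero hmp0]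
      intro Q hQ
      rw [← pow_two]
      exact hsq Q (Ideal.isPrime_of_prime hQ.prime)
    have hdvd : p.map (algebraMap A B) ∣ I :=
      (hsqf.dvd_pow_iff_dvd two_ne_zero).mp ⟨_, h⟩
    obtain ⟨I', rfl⟩ := hdvd
    have h2 : p.map (algebraMap A B) * I' ^ 2 = E.map (algebraMap A B) := by
      refine mul_left_cancel₀ hmp0 ?_
      rw [← h]; ring
    have hEp : p ∣ E := by
      rw [Ideal.dvd_iff_le]
      have hcomap : P.comap (algebraMap A B) = p := by
        have hm : p.IsMaximal := Ideal.IsPrime.isMaximal inferInstance hp0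
        refine (hm.eq_of_le (Ideal.comap_ne_top _ hP.ne_top) ?_).symm
        rwa [← Ideal.map_le_iff_le_comap]
      rw [← hcomap, ← Ideal.map_le_iff_le_comap, ← h2]
      exact Ideal.mul_le_left.trans hpP
    obtain ⟨F, rfl⟩ := hEp
    have hF0 : F ≠ ⊥ := right_ne_zero_of_mul hE0
    refine hmul _ _ (hmap p) (ih F ?_ hF0 I' ?_)
    · refine ⟨hF0, p * p, fun hu2 => hp.not_isUnit (isUnit_of_mul_isUnit_left hu2), by ring⟩
    · rw [Ideal.map_mul] at h2
      exact mul_left_cancel₀ hmp0 h2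

end DedekindBase

variable {A B : Type*} [CommRing A] [CommRing B] [IsDedekindDomain B] [Algebra A B]
  (τ : FixedInvolution A B)

/-- A square root of a principal ideal with generator of square norm is, up to a principal factor,
a square root of an ideal generated by an element of `A`. -/
theorem exists_sq_mul_span_eq_map (h2 : (2 : B) ≠ 0) {x : B} {w : A} (hx : x ≠ 0)
    (hw : x * τ.σ x = algebraMap A B (w ^ 2)) {b : Ideal B} (hb : b ^ 2 = Ideal.span {x}) :
    ∃ y : B, y ≠ 0 ∧ ∃ d : A, d ≠ 0 ∧
      (b * Ideal.span {y}) ^ 2 = (Ideal.span {d}).map (algebraMap A B) := by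
  have hσ : ∀ z, z ≠ 0 → τ.σ z ≠ 0 := fun z hz h => hz (by simpa using h)
  have hw0 : algebraMap A B w ≠ 0 := by
    rintro h
    rw [map_pow, h] at hw
    simp only [ne_eq, OfNat.ofNat_ne_zero, not_false_eq_true, zero_pow] at hw
    exact mul_ne_zero hx (hσ x hx) hw
  have main : ∀ w' : A, x * τ.σ x = algebraMap A B (w' ^ 2) → algebraMap A B w' ≠ 0 →
      algebraMap A B w' + x ≠ 0 → ∃ y : B, y ≠ 0 ∧ ∃ d : A, d ≠ 0 ∧
      (b * Ideal.span {y}) ^ 2 = (Ideal.span {d}).map (algebraMap A B) := by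
    intro w' hw' hw0' hne
    obtain ⟨n, hn⟩ := τ.exists_norm (algebraMap A B w' + x)
    refine ⟨τ.σ (algebraMap A B w' + x), hσ _ hne, w' * n, ?_, ?_⟩
    · rintro h
      have := congrArg (algebraMap A B) h
      rw [map_mul, map_zero, hn] at this
      exact mul_ne_zero hw0' (mul_ne_zero hne (hσ _ hne)) this
    · rw [mul_pow, hb, Ideal.span_singleton_pow, Ideal.span_singleton_mul_span_singleton,
        Ideal.map_span, Set.image_singleton, map_mul, hn]
      congr 2
      rw [map_add, τ.apply_algebraMap]
      rw [map_pow] at hw'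
      linear_combination (algebraMap A B w' + τ.σ x) * hw'
  by_cases h : algebraMap A B w + x = 0
  · refine main (-w) (by rw [neg_sq]; exact hw) (by rw [map_neg]; exact neg_ne_zero.mpr hw0) ?_
    rw [map_neg]
    rintro h'
    apply hw0
    have : (2 : B) * algebraMap A B w = 0 := by linear_combination h - h'
    exact (mul_eq_zero.mp this).resolve_left h2
  · exact main w hw hw0 h

/-- Hilbert 90 for units, in multiplied-out form. -/
theorem exists_eq_mul_apply {α : B} (hα : α ≠ 0) (hσα : τ.σ α = -α) {u : B}
    (hu : u * τ.σ u = 1) :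
    ∃ y : B, y ≠ 0 ∧ y = u * τ.σ y ∧ ∃ d : A, d ≠ 0 ∧
      (Ideal.span {y}) ^ 2 = (Ideal.span {d}).map (algebraMap A B) := by
  have hσ : ∀ z, z ≠ 0 → τ.σ z ≠ 0 := fun z hz h => hz (by simpa using h)
  obtain ⟨y, hy0, hy⟩ : ∃ y : B, y ≠ 0 ∧ y = u * τ.σ y := by
    by_cases h : 1 + u = 0
    · refine ⟨α, hα, ?_⟩
      rw [hσα]
      linear_combination α * h
    · refine ⟨1 + u, h, ?_⟩
      rw [map_add, map_one]
      linear_combination -hu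
  refine ⟨y, hy0, hy, ?_⟩
  obtain ⟨n, hn⟩ := τ.exists_norm y
  refine ⟨n, ?_, ?_⟩
  · rintro rfl
    rw [map_zero] at hn
    exact mul_ne_zero hy0 (hσ y hy0) hn.symm
  · rw [Ideal.map_span, Set.image_singleton, hn, Ideal.span_singleton_pow,
      Ideal.span_singleton_eq_span_singleton]
    refine ⟨Units.mk (τ.σ u) u (by rw [mul_comm]; exact hu) hu, ?_⟩
    simp only
    have h' : τ.σ y = τ.σ u * y := by
      conv_lhs => rw [hy]
      rw [map_mul, τ.apply_apply]
    rw [h']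
    ring

end FixedInvolution

theorem ZMod.exists_pow_four_eq_neg_one {p : ℕ} [Fact p.Prime] (hp : p % 8 = 1) :
    ∃ b : ZMod p, b ^ 4 = -1 := by
  have hp2 : p / 2 = 2 * (p / 4) := by omega
  obtain ⟨a, ha⟩ := (ZMod.exists_sq_eq_neg_one_iff (p := p)).mpr (by omega)
  have ha0 : a ≠ 0 := by rintro rfl; simp at ha
  have : IsSquare a := by
    rw [ZMod.euler_criterion p ha0, hp2, pow_mul, pow_two, ← ha,
      Even.neg_one_pow (by rw [Nat.even_iff]; omega)]
  obtain ⟨b, hb⟩ := this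
  exact ⟨b, by rw [ha, hb]; ring⟩

/-- An element killed by a character of order `4` is a fourth power residue. -/
theorem ZMod.pow_eq_one_of_mulChar_eq_one {p : ℕ} [Fact p.Prime] {R : Type*} [CommRing R]
    {χ : MulChar (ZMod p) R} (hχ : orderOf χ = 4) (u : (ZMod p)ˣ) (hu : χ u = 1) :
    (u : ZMod p) ^ ((p - 1) / 4) = 1 := by
  obtain ⟨g, hg⟩ := IsCyclic.exists_generator (α := (ZMod p)ˣ)
  obtain ⟨n, rfl⟩ := (mem_powers_iff_mem_zpowers).mpr (hg u)
  have h1 : χ ^ n = 1 := by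
    rw [MulChar.eq_iff hg, MulChar.one_apply_coe, MulChar.pow_apply_coe, ← map_pow]
    simpa using hu
  obtain ⟨m, rfl⟩ := (hχ ▸ orderOf_dvd_of_pow_eq_one h1 : 4 ∣ n)
  have h4 : 4 ∣ p - 1 := by
    have := MulChar.orderOf_dvd_card_sub_one (ZMod p) χ
    rwa [hχ, ZMod.card] at this
  simp only [Units.val_pow_eq_pow_val]
  rw [← pow_mul, mul_comm 4 m, mul_assoc, Nat.mul_div_cancel' h4, mul_comm, pow_mul,
    ZMod.pow_card_sub_one_eq_one g.ne_zero, one_pow]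

theorem gaussSum_pow_char_pow {p : ℕ} [Fact p.Prime] {R : Type*} [CommRing R] (l : ℕ) [Fact l.Prime]
    [CharP R l] (χ : MulChar (ZMod p) R) (ψ : AddChar (ZMod p) R) (n : ℕ) :
    gaussSum χ ψ ^ l ^ n = gaussSum (χ ^ l ^ n) (ψ ^ l ^ n) := by
  induction n with
  | zero => simp
  | succ n ih => rw [pow_succ, pow_mul, ih, gaussSum_frob, ← pow_mul, ← pow_mul]

theorem MulChar.exists_zmod_gaussianInt {p : ℕ} [Fact p.Prime] (hp : p % 8 = 1) :
    ∃ χ : MulChar (ZMod p) GaussianInt, orderOf χ = 4 ∧ χ (-1) = 1 ∧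
      χ.ringHomComp (starRingEnd GaussianInt) = χ⁻¹ ∧ (∃ u : (ZMod p)ˣ, χ u ^ 2 = -1) ∧
      ∃ A B : ℤ, jacobiSum χ χ = ⟨A, B⟩ ∧ A ^ 2 + B ^ 2 = p ∧ Odd A ∧ Even B := by
  have hpp : p.Prime := Fact.out
  have hI : IsPrimitiveRoot (⟨0, 1⟩ : GaussianInt) 4 := by
    rw [IsPrimitiveRoot.iff (by norm_num)]
    refine ⟨by decide, ?_⟩
    intro l hl hl4
    interval_cases l <;> decide
  obtain ⟨χ, hχ⟩ := MulChar.exists_mulChar_orderOf (ZMod p) (R := GaussianInt) (n := 4)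
    (by rw [ZMod.card]; omega) hI
  have hχ4 : χ ^ 4 = 1 := hχ ▸ pow_orderOf_eq_one χ
  have hχu : ∀ u : (ZMod p)ˣ, χ u ^ 4 = 1 := fun u => by
    rw [← MulChar.pow_apply_coe, hχ4, MulChar.one_apply_coe]
  have hχ2 : χ ^ 2 ≠ 1 := fun h => by
    have := orderOf_dvd_of_pow_eq_one h
    rw [hχ] at this
    norm_num at this
  have hχ1 : χ ≠ 1 := fun h => hχ2 (by rw [h, one_pow])
  have hu₀ : ∃ u : (ZMod p)ˣ, χ u ^ 2 = -1 := by
    by_contra! hcon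
    refine hχ2 (MulChar.ext fun u => ?_)
    rw [MulChar.pow_apply_coe, MulChar.one_apply_coe]
    have : (χ u ^ 2 - 1) * (χ u ^ 2 + 1) = 0 := by linear_combination hχu u
    rcases mul_eq_zero.mp this with h | h
    · linear_combination h
    · exact absurd (by linear_combination h) (hcon u)
  have hstar : χ.ringHomComp (starRingEnd GaussianInt) = χ⁻¹ := by
    rw [eq_inv_iff_mul_eq_one]
    have h1 : ∀ z : GaussianInt, z ^ 4 = 1 → (starRingEnd GaussianInt) z * z = 1 := by
      intro z hz
      have h3 : z.norm = 1 := by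
        have h4 : z.norm ^ 4 = 1 := by
          have := congrArg Zsqrtd.normMonoidHom hz
          rw [map_pow, map_one] at this
          exact this
        exact (pow_eq_one_iff_of_nonneg (GaussianInt.norm_nonneg z) (by norm_num)).mp h4
      rw [mul_comm, starRingEnd_apply, ← Zsqrtd.norm_eq_mul_conj z, h3]
      rfl
    refine MulChar.ext fun u => ?_
    rw [MulChar.mul_apply, MulChar.ringHomComp_apply, MulChar.one_apply_coe]
    exact h1 _ (hχu u)
  have hm1 : χ (-1) = 1 := by
    obtain ⟨b, hb⟩ := ZMod.exists_pow_four_eq_neg_one hp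
    have hb0 : b ≠ 0 := by
      rintro rfl
      simp at hb
    rw [← hb, map_pow, ← Units.val_mk0 hb0]
    exact hχu _
  refine ⟨χ, hχ, hm1, hstar, hu₀, (jacobiSum χ χ).re, (jacobiSum χ χ).im, rfl, ?_⟩
  constructor
  · have h1 : jacobiSum χ χ * (starRingEnd GaussianInt) (jacobiSum χ χ) = p := by
      apply GaussianInt.toComplex_injective
      have hinj := MulChar.injective_ringHomComp (R := ZMod p) GaussianInt.toComplex_injective
      have hne : ∀ {φ : MulChar (ZMod p) GaussianInt}, φ ≠ 1 →
          φ.ringHomComp GaussianInt.toComplex ≠ 1 := fun {φ} h h' =>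
        h (hinj (by simpa using h'))
      have := jacobiSum_mul_jacobiSum_inv (F := ZMod p) (F' := ℂ)
        (χ := χ.ringHomComp GaussianInt.toComplex) (φ := χ.ringHomComp GaussianInt.toComplex)
        (by rw [ZMod.ringChar_zmod_n, ringChar.eq_zero]; exact hpp.ne_zero.symm)
        (hne hχ1) (hne hχ1) (by
          rw [← pow_two, MulChar.ringHomComp_pow]
          exact hne hχ2)
      rw [← jacobiSum_ringHomComp, hstar, map_mul, map_natCast, ← jacobiSum_ringHomComp,
        ← jacobiSum_ringHomComp, ← MulChar.ringHomComp_inv, this, ZMod.card]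
    have h2 := congrArg Zsqrtd.re h1
    rw [starRingEnd_apply] at h2
    simp at h2
    linear_combination h2
  · obtain ⟨z, -, hz⟩ := exists_jacobiSum_eq_neg_one_add (F := ZMod p) (n := 4) (by norm_num)
      hχ4 hχ4 (by rw [ZMod.card]; omega) hI
    rw [hz]
    simp [pow_two]
    grind

/-- The rational quartic residue criterion behind the quartic subfield of `ℚ(ζ_p)`: there is a
representation `p = A² + B²` such that, over a finite field `F` containing `s = √p`, the cardinality
of `F` is a fourth power residue modulo `p` as soon as `2s(s + A)` or `2s(s - A)` is a nonzero
square in `F`. -/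
theorem exists_sq_add_sq_quartic_criterion {p : ℕ} [Fact p.Prime] (hp : p % 8 = 1) :
    ∃ A B : ℤ, A ^ 2 + B ^ 2 = p ∧ Odd A ∧ Even B ∧
      ∀ (F : Type) [Field F] [Fintype F], (2 : F) ≠ 0 → (p : F) ≠ 0 → ∀ s z : F, s ^ 2 = p → z ≠ 0 →
        (z ^ 2 = 2 * s * (s + A) ∨ z ^ 2 = 2 * s * (s - A)) →
        ((Fintype.card F : ℕ) : ZMod p) ^ ((p - 1) / 4) = 1 := by
  obtain ⟨χ, hχ, hm1, hstar, ⟨u₀, hu₀⟩, A, B, hJ, hAB, hA, hB⟩ := MulChar.exists_zmod_gaussianInt hp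
  refine ⟨A, B, hAB, hA, hB, ?_⟩
  intro F _ _ h2 hpF s z hs hz hzz
  obtain ⟨l, hlF, n, hl, hcard⟩ := FiniteField.card' F
  have : Fact l.Prime := ⟨hl⟩
  let Ω := AlgebraicClosure F
  have hinj : Function.Injective (algebraMap F Ω) := (algebraMap F Ω).injective
  have h2Ω : (2 : Ω) ≠ 0 := by
    have := (map_ne_zero_iff _ hinj).mpr h2
    rwa [map_ofNat] at this
  have hpΩ : (p : Ω) ≠ 0 := by
    have := (map_ne_zero_iff _ hinj).mpr hpF
    rwa [map_natCast] at this
  have : NeZero (p : Ω) := ⟨hpΩ⟩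
  obtain ⟨i, hi⟩ := IsAlgClosed.exists_pow_nat_eq (-1 : Ω) (n := 2) (by norm_num)
  let f : GaussianInt →+* Ω := Zsqrtd.lift ⟨i, by rw [← pow_two, hi]; simp⟩
  have hf : ∀ a b : ℤ, f ⟨a, b⟩ = a + b * i := fun a b => rfl
  obtain ⟨ζ, hζ⟩ := HasEnoughRootsOfUnity.exists_primitiveRoot Ω p
  obtain ⟨ψ, hψ⟩ : ∃ ψ : AddChar (ZMod p) Ω, ψ.IsPrimitive :=
    ⟨_, AddChar.zmodChar_primitive_of_primitive_root p hζ⟩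
  set φ := χ.ringHomComp f with hφ
  have hφ4 : φ ^ 4 = 1 := by
    rw [hφ, MulChar.ringHomComp_pow, ← hχ, pow_orderOf_eq_one, MulChar.ringHomComp_one]
  have hφ2 : φ ^ 2 ≠ 1 := fun h => by
    have h1 := DFunLike.congr_fun h (u₀ : ZMod p)
    rw [MulChar.pow_apply_coe, MulChar.one_apply_coe, MulChar.ringHomComp_apply, ← map_pow, hu₀,
      map_neg, map_one] at h1
    exact h2Ω (by linear_combination -h1)
  have hφinv : φ⁻¹ = φ ^ 3 := by
    rw [inv_eq_iff_mul_eq_one, ← pow_succ', hφ4]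
  have hφ1 : φ ≠ 1 := fun h => hφ2 (by rw [h, one_pow])
  have hφm1 : φ (-1) = 1 := by rw [MulChar.ringHomComp_apply, hm1, map_one]
  have hφim1 : (φ ^ 2) (-1) = 1 := by
    rw [MulChar.pow_apply' _ two_ne_zero, hφm1, one_pow]
  set G := gaussSum φ ψ with hG
  set G' := gaussSum φ⁻¹ ψ with hG'
  set g := gaussSum (φ ^ 2) ψ with hg
  have e1 : g * (A + B * i) = G ^ 2 := by
    rw [← hf, ← hJ, ← jacobiSum_ringHomComp, hg, pow_two φ,
      jacobiSum_mul_nontrivial (by rwa [← pow_two]), hG, pow_two]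
  have e2 : g * (A - B * i) = G' ^ 2 := by
    have h3 : (A - B * i : Ω) = f ((starRingEnd GaussianInt) (jacobiSum χ χ)) := by
      rw [hJ, starRingEnd_apply, Zsqrtd.star_mk, hf]
      push_cast
      ring
    have h4 : φ ^ 2 = φ⁻¹ * φ⁻¹ := by
      rw [hφinv, ← pow_add, show 3 + 3 = 4 + 2 from rfl, pow_add, hφ4, one_mul]
    rw [h3, ← jacobiSum_ringHomComp, hstar, ← jacobiSum_ringHomComp, ← MulChar.ringHomComp_inv,
      ← hφ, hg, h4, jacobiSum_mul_nontrivial (by rwa [← h4]), hG', pow_two]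
  have e3 : G * G' = p := by
    have := gaussSum_mul_gaussSum_eq_card hφ1 hψ
    rw [ZMod.card] at this
    rw [← this, hG', ← mul_gaussSum_inv_eq_gaussSum φ⁻¹, MulChar.inv_apply', inv_neg, inv_one,
      hφm1, one_mul]
  have e4 : g ^ 2 = p := by
    have := gaussSum_mul_gaussSum_eq_card hφ2 hψ
    rw [ZMod.card] at this
    have h4 : (φ ^ 2)⁻¹ = φ ^ 2 := by
      rw [inv_eq_iff_mul_eq_one, ← pow_add, hφ4]
    rw [← this, pow_two, h4]
    congr 1
    rw [hg, ← mul_gaussSum_inv_eq_gaussSum (φ ^ 2), hφim1, one_mul]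
  set q := Fintype.card F with hq
  have hqp : IsUnit ((q : ℕ) : ZMod p) := by
    rw [hcard, Nat.cast_pow, isUnit_iff_ne_zero]
    refine pow_ne_zero _ fun h => hpF ?_
    rw [ZMod.natCast_eq_zero_iff, Nat.prime_dvd_prime_iff_eq Fact.out hl] at h
    rw [h, CharP.cast_eq_zero]
  obtain ⟨u, hu⟩ := hqp
  have hqodd : q % 2 = 1 := by
    by_contra h
    have h3 : 2 ∣ l := Nat.prime_two.dvd_of_dvd_pow (hcard ▸ (by omega : 2 ∣ q))
    rw [Nat.prime_dvd_prime_iff_eq Nat.prime_two hl] at h3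
    subst h3
    exact h2 (by simpa using CharP.cast_eq_zero F 2)
  have hfr : ∀ χ' : MulChar (ZMod p) Ω, (χ' ^ q) u * gaussSum χ' ψ ^ q = gaussSum (χ' ^ q) ψ := by
    intro χ'
    rw [hcard, gaussSum_pow_char_pow, ← hcard, AddChar.pow_mulShift, ← hu, gaussSum_mulShift]
  set κ := φ u with hκ
  have hS : (algebraMap F Ω s) ^ 2 = p := by rw [← map_pow, hs, map_natCast]
  have hgs : g = algebraMap F Ω s ∨ g = - algebraMap F Ω s := by
    rw [← sq_eq_sq_iff_eq_or_eq_neg, e4, hS]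
  have hFq : ∀ x : F, (algebraMap F Ω x) ^ q = algebraMap F Ω x := fun x => by
    rw [← map_pow, FiniteField.pow_card]
  have hgq : g ^ q = g := by
    rcases hgs with h | h
    · rw [h, hFq]
    · rw [h, Odd.neg_pow (Nat.odd_iff.mpr hqodd), hFq]
  have hg0 : g ≠ 0 := fun h => hpΩ (by rw [← e4, h]; ring)
  have hφpow : ∀ a b : ℕ, a % 4 = b % 4 → φ ^ a = φ ^ b := fun a b h => by
    rw [← Nat.div_add_mod a 4, ← Nat.div_add_mod b 4, pow_add, pow_add, pow_mul, pow_mul, hφ4, h,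
      one_pow, one_pow]
  have hκ2 : κ ^ 2 = 1 := by
    have h3 := hfr (φ ^ 2)
    rw [← pow_mul, hφpow (2 * q) 2 (by omega), ← hg, hgq, MulChar.pow_apply_coe, ← hκ] at h3
    exact mul_right_cancel₀ hg0 (by rw [h3, one_mul])
  have hκ3 : (φ ^ 3) u = κ := by
    rw [MulChar.pow_apply_coe, ← hκ]
    linear_combination κ * hκ2
  have hadd : ∀ x y : Ω, (x + y) ^ q = x ^ q + y ^ q := fun x y => by
    have : CharP Ω l := AlgebraicClosure.instCharP F
    rw [hcard, add_pow_char_pow]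
  have hW : (algebraMap F Ω z) ^ 2 = (G + G') ^ 2 ∨
      (algebraMap F Ω z) ^ 2 = (i * (G - G')) ^ 2 := by
    have h3 : (algebraMap F Ω z) ^ 2 = 2 * g * (g + A) ∨
        (algebraMap F Ω z) ^ 2 = 2 * g * (g - A) := by
      rw [← map_pow]
      rcases hgs with h | h <;> rcases hzz with h' | h' <;> rw [h, h'] <;>
        simp only [map_mul, map_add, map_sub, map_ofNat, map_intCast]
      · exact Or.inl trivial
      · exact Or.inr trivial
      · exact Or.inr (by ring)
      · exact Or.inl (by ring)
    rcases h3 with h3 | h3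
    · exact Or.inl (by linear_combination h3 + e1 + e2 + 2 * e4 - 2 * e3)
    · exact Or.inr (by linear_combination h3 - e1 - e2 + 2 * e4 - 2 * e3 - (G - G') ^ 2 * hi)
  have hz0 : algebraMap F Ω z ≠ 0 := (map_ne_zero_iff _ hinj).mpr hz
  have hκ1 : κ = 1 := by
    have hodd : ∀ x : Ω, (-x) ^ q = -x ^ q := fun x => Odd.neg_pow (Nat.odd_iff.mpr hqodd) x
    have key : κ * (algebraMap F Ω z) ^ q = algebraMap F Ω z := by
      have hcase : (i ^ q = i ∧ κ * G ^ q = G ∧ κ * G' ^ q = G') ∨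
          (i ^ q = -i ∧ κ * G ^ q = G' ∧ κ * G' ^ q = G) := by
        have h3 := hfr φ
        have h4 := hfr (φ ^ 3)
        have h5 := Nat.div_add_mod q 4
        rw [← pow_mul] at h4
        rcases (by omega : q % 4 = 1 ∨ q % 4 = 3) with h | h <;> rw [h] at h5
        · refine Or.inl ⟨?_, ?_, ?_⟩
          · rw [← h5, show 4 * (q / 4) + 1 = 2 * (2 * (q / 4)) + 1 by ring, pow_succ, pow_mul, hi,
              Even.neg_one_pow (even_two_mul _), one_mul]
          · rwa [hφpow q 1 h, pow_one] at h3
          · rwa [hφpow (3 * q) 3 (by omega), hκ3, ← hφinv] at h4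
        · refine Or.inr ⟨?_, ?_, ?_⟩
          · rw [← h5, show 4 * (q / 4) + 3 = 2 * (2 * (q / 4) + 1) + 1 by ring, pow_succ, pow_mul,
              hi, Odd.neg_one_pow (odd_two_mul_add_one _), neg_one_mul]
          · rwa [hφpow q 3 h, hκ3, ← hφinv] at h3
          · rwa [hφpow (3 * q) 1 (by omega), pow_one, ← hφinv] at h4
      have hsgn : ∀ x y : Ω, x ^ 2 = y ^ 2 → κ * y ^ q = y → κ * x ^ q = x := by
        intro x y hxy h
        rcases sq_eq_sq_iff_eq_or_eq_neg.mp hxy with rfl | rfl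
        · exact h
        · rw [hodd, mul_neg, h]
      rcases hW with h | h
      · refine hsgn _ _ h ?_
        rw [hadd, mul_add]
        rcases hcase with ⟨-, h3, h4⟩ | ⟨-, h3, h4⟩ <;> rw [h3, h4]
        ring
      · refine hsgn _ _ h ?_
        rw [mul_pow, sub_eq_add_neg, hadd, hodd]
        rcases hcase with ⟨h2, h3, h4⟩ | ⟨h2, h3, h4⟩ <;> rw [h2]
        · linear_combination i * (h3 - h4)
        · linear_combination (-i) * (h3 - h4)
    rw [hFq] at key
    exact mul_right_cancel₀ hz0 (by rw [key, one_mul])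
  have hχ1 : χ u = 1 := by
    have h3 : f (χ u) = 1 := hκ1
    have h4 : (χ u - 1) * ((χ u + 1) * (χ u ^ 2 + 1)) = 0 := by
      have : χ u ^ 4 = 1 := by
        rw [← MulChar.pow_apply_coe, ← hχ, pow_orderOf_eq_one, MulChar.one_apply_coe]
      linear_combination this
    rcases mul_eq_zero.mp h4 with h | h
    · linear_combination h
    have h5 := congrArg f h
    rw [map_mul, map_add, map_add, map_pow, h3, map_one, map_zero] at h5
    exact absurd (by linear_combination h5) (mul_ne_zero h2Ω h2Ω)
  rw [← hu]
  exact ZMod.pow_eq_one_of_mulChar_eq_one hχ u hχ1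

namespace NumberField.Units

variable {L : Type*} [Field L] [NumberField L]

theorem eq_one_or_eq_neg_one_of_mem_torsion (ι : L →+* ℝ) {u : (𝓞 L)ˣ} (hu : u ∈ torsion L) :
    u = 1 ∨ u = -1 := by
  obtain ⟨n, hn, h⟩ := isOfFinOrder_iff_pow_eq_one.mp ((CommGroup.mem_torsion _).mp hu)
  have hinj : Function.Injective fun v : (𝓞 L)ˣ => ι (v : 𝓞 L) := fun v w h =>
    Units.ext (RingOfIntegers.ext (ι.injective h))
  have h1 : (ι (u : 𝓞 L)) ^ n = 1 := by
    rw [← map_pow, ← map_pow, ← Units.val_pow_eq_pow_val, h]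
    simp
  have h2 : |ι (u : 𝓞 L)| = 1 := by
    rw [← pow_eq_one_iff_of_nonneg (abs_nonneg _) hn.ne', ← abs_pow, h1, abs_one]
  rcases (abs_eq zero_le_one).mp h2 with h3 | h3
  · exact Or.inl (hinj (by simpa using h3))
  · exact Or.inr (hinj (by simpa using h3))

/-- For a number field with a real embedding, the units modulo squares and sign form an
elementary abelian `2`-group whose rank is the unit rank. -/
theorem exists_hom_zmod_two (ι : L →+* ℝ) :
    ∃ e : (𝓞 L)ˣ → Fin (rank L) → ZMod 2, Function.Surjective e ∧
      (∀ u v, e (u * v) = e u + e v) ∧ (∀ u, e (-u) = e u) ∧ (∀ u, e (u ^ 2) = 0) ∧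
      ∀ u, e u = 0 → ∃ v, u = v ^ 2 ∨ u = -v ^ 2 := by
  choose c hc hcu using fun u => exist_unique_eq_mul_prod L u
  have hcmul : ∀ u v, (c (u * v)).2 = (c u).2 + (c v).2 := fun u v => by
    rw [← hcu (u * v) ((c u).1 * (c v).1, (c u).2 + (c v).2)]
    have h1 := hc u
    have h2 := hc v
    simp only [Pi.add_apply, zpow_add, Finset.prod_mul_distrib, Subgroup.coe_mul]
    conv_lhs => rw [h1, h2]
    exact mul_mul_mul_comm _ _ _ _
  have hcsurj : ∀ f, ∃ u, (c u).2 = f := fun f => by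
    refine ⟨∏ i, fundSystem L i ^ f i, ?_⟩
    rw [← hcu _ (1, f) (by simp)]
  have hcker : ∀ u, (c u).2 = 0 → u = 1 ∨ u = -1 := fun u hu => by
    apply eq_one_or_eq_neg_one_of_mem_torsion ι
    rw [hc u, hu]
    simp
  have hcneg : ∀ u, (c (-u)).2 = (c u).2 := fun u => by
    have h1 : (c (-u)).2 + (c (-u)).2 = (c u).2 + (c u).2 := by
      rw [← hcmul, ← hcmul, neg_mul_neg]
    funext i
    have := congrFun h1 i
    simp only [Pi.add_apply] at this
    omega
  refine ⟨fun u i => ((c u).2 i : ZMod 2), fun f => ?_, fun u v => ?_, fun u => ?_, fun u => ?_,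
    fun u hu => ?_⟩
  · obtain ⟨u, hu⟩ := hcsurj fun i => ((f i).val : ℤ)
    exact ⟨u, by funext i; simp [hu]⟩
  · funext i
    simp [hcmul]
  · simp only [hcneg]
  · funext i
    simp only [pow_two, hcmul, Pi.add_apply, Int.cast_add]
    exact CharTwo.add_self_eq_zero _
  · have h2 : ∀ i, ∃ m, (c u).2 i = 2 * m := fun i => by
      have := congrFun hu i
      exact (ZMod.intCast_zmod_eq_zero_iff_dvd _ 2).mp this
    choose m hm using h2
    obtain ⟨v, hv⟩ := hcsurj m
    refine ⟨v, ?_⟩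
    have h3 : (c (u * (v ^ 2)⁻¹)).2 = 0 := by
      have h4 : (c (u * (v ^ 2)⁻¹)).2 + ((c v).2 + (c v).2) = (c u).2 := by
        rw [← hcmul, ← hcmul, pow_two, inv_mul_cancel_right]
      funext i
      have h5 := congrFun h4 i
      simp only [Pi.add_apply, hm, hv] at h5
      simp only [Pi.zero_apply]
      omega
    rcases hcker _ h3 with h | h
    · exact Or.inl (mul_inv_eq_one.mp h)
    · exact Or.inr (by rw [mul_inv_eq_iff_eq_mul] at h; rw [h, neg_one_mul])

/-- If the unit rank is at least `2`, a number field with a real embedding has a unit that is not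
in the group generated by a given unit, the squares and `-1`. -/
theorem exists_ne_sq_mul (ι : L →+* ℝ) (ε : (𝓞 L)ˣ) (h : 2 ≤ rank L) :
    ∃ u : (𝓞 L)ˣ, ∀ v, u ≠ v ^ 2 ∧ u ≠ -v ^ 2 ∧ u ≠ ε * v ^ 2 ∧ u ≠ -(ε * v ^ 2) := by
  by_contra! hcon
  obtain ⟨e, hsurj, hmul, hneg, hsq, -⟩ := exists_hom_zmod_two ι
  have hval : ∀ u, e u = 0 ∨ e u = e ε := fun u => by
    obtain ⟨v, hv⟩ := hcon u
    by_cases h1 : u = v ^ 2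
    · exact Or.inl (by rw [h1, hsq])
    by_cases h2 : u = -v ^ 2
    · exact Or.inl (by rw [h2, hneg, hsq])
    by_cases h3 : u = ε * v ^ 2
    · exact Or.inr (by rw [h3, hmul, hsq, add_zero])
    · exact Or.inr (by rw [hv h1 h2 h3, hneg, hmul, hsq, add_zero])
  have h1 : Fintype.card (Fin (rank L) → ZMod 2) ≤ ({0, e ε} : Finset _).card := by
    refine Finset.card_le_card fun f _ => ?_
    obtain ⟨u, rfl⟩ := hsurj f
    simpa using hval u
  have h2 := h1.trans Finset.card_le_two
  rw [Fintype.card_fun, ZMod.card, Fintype.card_fin] at h2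
  have h3 : 2 ^ 2 ≤ 2 ^ rank L := Nat.pow_le_pow_right (by norm_num) h
  omega

theorem exists_ne_sq (ι : L →+* ℝ) (h : 1 ≤ rank L) :
    ∃ u : (𝓞 L)ˣ, ∀ v, u ≠ v ^ 2 ∧ u ≠ -v ^ 2 := by
  by_contra! hcon
  obtain ⟨e, hsurj, hmul, hneg, hsq, -⟩ := exists_hom_zmod_two ι
  obtain ⟨u, hu⟩ := hsurj (fun _ => 1)
  have h1 : e u = 0 := by
    obtain ⟨v, hv⟩ := hcon u
    by_cases h1 : u = v ^ 2
    · rw [h1, hsq]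
    · rw [hv h1, hneg, hsq]
  exact absurd (congrFun (hu.symm.trans h1) ⟨0, h⟩) one_ne_zero

theorem eq_sq_mul_of_rank_eq_one (ι : L →+* ℝ) (h : rank L = 1) {ε : (𝓞 L)ˣ}
    (hε : ∀ v, ε ≠ v ^ 2 ∧ ε ≠ -v ^ 2) (u : (𝓞 L)ˣ) :
    ∃ v, u = v ^ 2 ∨ u = -v ^ 2 ∨ u = ε * v ^ 2 ∨ u = -(ε * v ^ 2) := by
  obtain ⟨e, -, hmul, hneg, hsq, hker⟩ := exists_hom_zmod_two ι
  have h2 : ∀ x : ZMod 2, x ≠ 0 → x = 1 := by decide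
  have hne : ∀ v, e v ≠ 0 → ∀ i, e v i = 1 := fun v hv i => by
    refine h2 _ fun h3 => hv (funext fun j => ?_)
    have : j = i := by apply Fin.ext; omega
    rw [this, h3]
    rfl
  by_cases hu : e u = 0
  · obtain ⟨v, hv | hv⟩ := hker u hu
    exacts [⟨v, Or.inl hv⟩, ⟨v, Or.inr (Or.inl hv)⟩]
  have hε0 : e ε ≠ 0 := fun h3 => by
    obtain ⟨v, hv⟩ := hker ε h3
    exact hv.elim (hε v).1 (hε v).2
  obtain ⟨v, hv⟩ := hker (ε * u) (by
    rw [hmul]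
    funext i
    rw [Pi.add_apply, hne _ hu, hne _ hε0]
    rfl)
  have key : ∀ w : (𝓞 L)ˣ, ε * u = w → u = ε * (w * ε⁻¹ ^ 2) := fun w hw => by
    rw [← hw, mul_comm ε u, mul_assoc, mul_left_comm, inv_pow, pow_two]
    group
  refine ⟨v * ε⁻¹, Or.inr (Or.inr ?_)⟩
  rcases hv with hv | hv
  · exact Or.inl (by rw [mul_pow]; exact key _ hv)
  · exact Or.inr (by rw [mul_pow, ← mul_neg, ← neg_mul]; exact key _ hv)

theorem nrRealPlaces_pos (ι : L →+* ℝ) : 0 < InfinitePlace.nrRealPlaces L := by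
  classical
  rw [InfinitePlace.nrRealPlaces, Fintype.card_pos_iff]
  refine ⟨⟨InfinitePlace.mk (Complex.ofRealHom.comp ι), ?_⟩⟩
  rw [InfinitePlace.isReal_mk_iff, ComplexEmbedding.isReal_iff]
  ext x
  simp

theorem rank_eq_one_of_finrank_eq_two (ι : L →+* ℝ) (h : Module.finrank ℚ L = 2) : rank L = 1 := by
  have h1 := InfinitePlace.card_add_two_mul_card_eq_rank L
  have h2 := InfinitePlace.card_eq_nrRealPlaces_add_nrComplexPlaces L
  have h3 := nrRealPlaces_pos ι
  rw [rank, h2]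
  omega

theorem two_le_rank_of_finrank_eq_four (ι : L →+* ℝ) (h : Module.finrank ℚ L = 4) :
    2 ≤ rank L := by
  have h1 := InfinitePlace.card_add_two_mul_card_eq_rank L
  have h2 := InfinitePlace.card_eq_nrRealPlaces_add_nrComplexPlaces L
  have h3 := nrRealPlaces_pos ι
  rw [rank, h2]
  omega

end NumberField.Units

theorem Ideal.exists_eq_span_of_mul_span_eq_span {R : Type*} [CommRing R] [IsDedekindDomain R]
    {I : Ideal R} {y z : R} (hy : y ≠ 0) (h : I * Ideal.span {y} = Ideal.span {z}) :
    ∃ c, I = Ideal.span {c} ∧ c * y = z := by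
  obtain ⟨c, -, hcz⟩ := Ideal.mem_mul_span_singleton.mp (h ▸ Ideal.mem_span_singleton_self z)
  refine ⟨c, ?_, hcz⟩
  rw [← hcz, ← Ideal.span_singleton_mul_span_singleton] at h
  exact mul_right_cancel₀ (by simpa using hy) h

theorem NumberField.exists_pow_classNumber_eq_span {L : Type*} [Field L] [NumberField L]
    (I : Ideal (𝓞 L)) : ∃ c, I ^ classNumber L = Ideal.span {c} := by
  by_cases hI : I = ⊥
  · exact ⟨0, by rw [hI, ← Ideal.zero_eq_bot,
      zero_pow (by simp [classNumber, Fintype.card_ne_zero]),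
      Ideal.zero_eq_bot, Ideal.span_singleton_eq_bot.mpr rfl]⟩
  have h1 : ClassGroup.mk0 ⟨I, mem_nonZeroDivisors_of_ne_zero hI⟩ ^ classNumber L = 1 :=
    pow_card_eq_one
  rw [← map_pow, ClassGroup.mk0_eq_one_iff] at h1
  obtain ⟨c, hc⟩ := h1.principal
  exact ⟨c, hc⟩

/-- The real quadratic field `ℚ(√p)` with the chosen root `s` of `p`, the conjugation, and the
real embedding for which `s` is negative. -/
structure RealQuadratic (p : ℕ) (k : Type) [Field k] [NumberField k] where
  s : 𝓞 k
  ω : 𝓞 k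
  τ : FixedInvolution ℤ (𝓞 k)
  ι : k →+* ℝ
  s_sq : s ^ 2 = p
  two_mul_ω : 2 * ω = 1 + s
  apply_s : τ.σ s = -s
  norm_eq : ∀ x, ((Algebra.norm ℤ x : ℤ) : 𝓞 k) = x * τ.σ x
  ι_s : ι s < 0
  finrank_eq : Module.finrank ℚ k = 2

namespace RealQuadratic

variable {p : ℕ} {k : Type} [Field k] [NumberField k] (Q : RealQuadratic p k)

theorem s_ne_zero [Fact p.Prime] : Q.s ≠ 0 := fun h => by
  have := Q.s_sq
  rw [h, zero_pow two_ne_zero] at this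
  exact (Fact.out : p.Prime).ne_zero (by exact_mod_cast this.symm)

theorem absNorm_span_s [Fact p.Prime] : Ideal.absNorm (Ideal.span {Q.s}) = p := by
  have h1 : Algebra.norm ℤ Q.s = -p := by
    have h2 := Q.norm_eq Q.s
    rw [Q.apply_s, mul_neg, ← pow_two, Q.s_sq] at h2
    have h3 : ((Algebra.norm ℤ Q.s : ℤ) : 𝓞 k) = ((-p : ℤ) : 𝓞 k) := by rw [h2]; simp
    exact Int.cast_injective h3
  rw [Ideal.absNorm_span_singleton, h1]
  simp

theorem isPrime_span_s [Fact p.Prime] : (Ideal.span {Q.s}).IsPrime :=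
  Ideal.isPrime_of_irreducible_absNorm (by
    rw [Q.absNorm_span_s]
    exact (Fact.out : p.Prime))

theorem prime_s [Fact p.Prime] : Prime Q.s :=
  (Ideal.span_singleton_prime Q.s_ne_zero).mp Q.isPrime_span_s

theorem ω_sub_apply : Q.ω - Q.τ.σ Q.ω = Q.s := by
  have h1 := congrArg Q.τ.σ Q.two_mul_ω
  rw [map_mul, map_add, map_one, map_ofNat, Q.apply_s] at h1
  have h2 : (2 : 𝓞 k) ≠ 0 := two_ne_zero
  apply mul_left_cancel₀ h2
  linear_combination Q.two_mul_ω - h1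

/-- An ideal whose square is extended from `ℤ` has a generator that is fixed up to sign. -/
theorem exists_span_eq_of_sq_eq_map [Fact p.Prime] {D : Ideal ℤ} (hD : D ≠ ⊥) {I : Ideal (𝓞 k)}
    (h : I ^ 2 = D.map (algebraMap ℤ (𝓞 k))) :
    ∃ x, I = Ideal.span {x} ∧ (Q.τ.σ x = x ∨ Q.τ.σ x = -x) := by
  have hpp : p.Prime := Fact.out
  have hinj : Function.Injective (algebraMap ℤ (𝓞 k)) := FaithfulSMul.algebraMap_injective _ _
  refine FixedInvolution.induction_of_sq_eq_map hinj
    (C := fun I => ∃ x, I = Ideal.span {x} ∧ (Q.τ.σ x = x ∨ Q.τ.σ x = -x)) ?_ ?_ ?_ D hD I h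
  · intro J
    obtain ⟨n, rfl⟩ := IsPrincipalIdealRing.principal J |>.principal
    exact ⟨n, by rw [← Ideal.submodule_span_eq, Ideal.map_span]; simp, Or.inl (by simp)⟩
  · rintro _ _ ⟨x, rfl, hx⟩ ⟨y, rfl, hy⟩
    refine ⟨x * y, Ideal.span_singleton_mul_span_singleton _ _, ?_⟩
    rw [map_mul]
    rcases hx with hx | hx <;> rcases hy with hy | hy <;> rw [hx, hy] <;> simp
  · intro q hq hq0
    by_cases hpq : (p : ℤ) ∈ q
    · left
      refine ⟨Ideal.span {Q.s}, ⟨Q.s, rfl, Or.inr Q.apply_s⟩, ?_⟩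
      have : q = Ideal.span {(p : ℤ)} := by
        have hmax : (Ideal.span {(p : ℤ)}).IsMaximal :=
          PrincipalIdealRing.isMaximal_of_irreducible
            (Nat.prime_iff_prime_int.mp hpp).irreducible
        exact (hmax.eq_of_le hq.ne_top (by rwa [Ideal.span_singleton_le_iff_mem])).symm
      rw [this, Ideal.map_span, Ideal.span_singleton_pow, Q.s_sq]
      simp
    · right
      have hcop : ∀ P : Ideal (𝓞 k), P.IsPrime → q.map (algebraMap ℤ (𝓞 k)) ≤ P → Q.s ∉ P := by
        intro P hP hle hs
        have hpP : (p : 𝓞 k) ∈ P := by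
          rw [← Q.s_sq]
          exact P.pow_mem_of_mem hs 2 two_pos
        have h1 : q ⊔ Ideal.span {(p : ℤ)} = ⊤ := by
          have hmax := hq.isMaximal hq0
          apply (Ideal.isMaximal_def.mp hmax).2
          rw [left_lt_sup, Ideal.span_singleton_le_iff_mem]
          exact hpq
        have h2 : (⊤ : Ideal ℤ) ≤ P.comap (algebraMap ℤ (𝓞 k)) := by
          rw [← h1, sup_le_iff, Ideal.span_singleton_le_iff_mem, Ideal.mem_comap]
          exact ⟨Ideal.map_le_iff_le_comap.mp hle, by simpa using hpP⟩
        exact hP.ne_top (Ideal.comap_eq_top_iff.mp (top_le_iff.mp h2))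
      constructor
      · obtain ⟨P, hP, h1⟩ := Ideal.exists_ideal_over_prime_of_isIntegral (S := 𝓞 k) q ⊥ (by
          rw [Ideal.comap_bot_of_injective _ hinj]
          exact bot_le)
        refine ⟨P, h1.1, ?_⟩
        exact Ideal.map_le_iff_le_comap.mpr h1.2.ge
      · intro P hP hdvd
        have hle : q.map (algebraMap ℤ (𝓞 k)) ≤ P :=
          (Ideal.le_of_dvd hdvd).trans (Ideal.pow_le_self two_ne_zero)
        refine Q.τ.not_sq_dvd_map hq0 hinj (y := Q.ω) ?_ hdvd
        rw [Q.ω_sub_apply]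
        exact hcop P hP hle

theorem exists_norm_eq_neg_one [Fact p.Prime] (Q : RealQuadratic p k) :
    ∃ u : (𝓞 k)ˣ, (u : 𝓞 k) * Q.τ.σ u = -1 := by
  by_contra! hcon
  have hnorm : ∀ u : (𝓞 k)ˣ, (u : 𝓞 k) * Q.τ.σ u = 1 := fun u => by
    have h1 : IsUnit (Algebra.norm ℤ (u : 𝓞 k)) := u.isUnit.map _
    rw [← Q.norm_eq]
    rcases Int.isUnit_iff.mp h1 with h | h
    · rw [h, Int.cast_one]
    · exact absurd (by rw [← Q.norm_eq, h]; simp) (hcon u)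
  obtain ⟨u, hu⟩ := NumberField.Units.exists_ne_sq Q.ι
    (NumberField.Units.rank_eq_one_of_finrank_eq_two Q.ι Q.finrank_eq).ge
  obtain ⟨y, hy0, hyu, d, hd, hyd⟩ := Q.τ.exists_eq_mul_apply Q.s_ne_zero Q.apply_s (hnorm u)
  obtain ⟨x, hx, hσx⟩ := Q.exists_span_eq_of_sq_eq_map (by simpa using hd) hyd
  obtain ⟨v, hv⟩ := Ideal.span_singleton_eq_span_singleton.mp hx.symm
  have hx0 : x ≠ 0 := by
    rintro rfl
    exact hy0 (by rw [← hv, zero_mul])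
  have hv1 := hnorm v
  rw [← hv, map_mul] at hyu
  rcases hσx with h | h <;> rw [h] at hyu
  · refine (hu v).1 (Units.ext ?_)
    apply mul_left_cancel₀ hx0
    push_cast
    linear_combination -(v:𝓞 k) * hyu + (-u * x) * hv1
  · refine (hu v).2 (Units.ext ?_)
    apply mul_left_cancel₀ hx0
    push_cast
    linear_combination (v:𝓞 k) * hyu - (u * x) * hv1

/-- The class group of `ℚ(√p)` has no `2`-torsion. -/
theorem exists_eq_span_of_sq [Fact p.Prime] (Q : RealQuadratic p k) {b : Ideal (𝓞 k)} {x : 𝓞 k}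
    (h : b ^ 2 = Ideal.span {x}) :
    ∃ z, b = Ideal.span {z} := by
  by_cases hx : x = 0
  · refine ⟨0, ?_⟩
    subst hx
    rw [Ideal.span_singleton_eq_bot.mpr rfl] at h ⊢
    exact pow_eq_zero_iff two_ne_zero |>.mp h
  have h1 : Algebra.norm ℤ x = (Ideal.absNorm b : ℤ) ^ 2 ∨
      Algebra.norm ℤ x = -(Ideal.absNorm b : ℤ) ^ 2 := by
    have h2 := congrArg Ideal.absNorm h
    rw [map_pow, Ideal.absNorm_span_singleton] at h2
    rcases Int.natAbs_eq (Algebra.norm ℤ x) with h3 | h3 <;> rw [← h2] at h3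
    · exact Or.inl (by exact_mod_cast h3)
    · exact Or.inr (by exact_mod_cast h3)
  obtain ⟨x', hx', hb', hn'⟩ : ∃ x' ≠ 0, b ^ 2 = Ideal.span {x'} ∧
      x' * Q.τ.σ x' = algebraMap ℤ (𝓞 k) ((Ideal.absNorm b : ℤ) ^ 2) := by
    rcases h1 with h1 | h1
    · refine ⟨x, hx, h, ?_⟩
      rw [← Q.norm_eq, h1]
      simp
    · obtain ⟨u, hu⟩ := Q.exists_norm_eq_neg_one
      refine ⟨x * u, mul_ne_zero hx u.ne_zero, ?_, ?_⟩
      · rw [h, Ideal.span_singleton_mul_right_unit u.isUnit]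
      · have h2 := Q.norm_eq x
        rw [h1] at h2
        push_cast at h2
        rw [map_mul]
        simp only [map_pow, map_natCast]
        linear_combination (x * Q.τ.σ x) * hu + h2
  obtain ⟨y, hy, d, hd, hyd⟩ := Q.τ.exists_sq_mul_span_eq_map two_ne_zero hx' hn' hb'
  obtain ⟨z, hz, -⟩ := Q.exists_span_eq_of_sq_eq_map (by simpa using hd) hyd
  obtain ⟨c, hc, -⟩ := Ideal.exists_eq_span_of_mul_span_eq_span hy hz
  exact ⟨c, hc⟩

theorem odd_classNumber [Fact p.Prime] (Q : RealQuadratic p k) : Odd (classNumber k) := by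
  rw [← Nat.not_even_iff_odd, even_iff_two_dvd, classNumber]
  intro h
  obtain ⟨C, hC⟩ := exists_prime_orderOf_dvd_card 2 h
  obtain ⟨I, rfl⟩ := ClassGroup.mk0_surjective C
  have h1 := pow_orderOf_eq_one (ClassGroup.mk0 I)
  rw [hC, ← map_pow, ClassGroup.mk0_eq_one_iff] at h1
  obtain ⟨x, hx⟩ := h1.principal
  obtain ⟨z, hz⟩ := Q.exists_eq_span_of_sq (b := I) (x := x) (by
    rw [← Ideal.submodule_span_eq, ← hx]
    rfl)
  have h2 : ClassGroup.mk0 I = 1 := by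
    rw [ClassGroup.mk0_eq_one_iff, hz]
    exact ⟨z, rfl⟩
  rw [h2, orderOf_one] at hC
  norm_num at hC

/-- The prime ideals modulo which a suitable unit `ε` of norm `-1` times `s` is a square have a norm
that is a fourth power residue modulo `p`. -/
theorem exists_unit_absNorm_pow_eq_one [Fact p.Prime] (Q : RealQuadratic p k) (hp : p % 8 = 1) :
    ∃ ε : (𝓞 k)ˣ, (ε : 𝓞 k) * Q.τ.σ ε = -1 ∧ Q.ι (ε : 𝓞 k) < 0 ∧
      ∀ l : Ideal (𝓞 k), l.IsMaximal → (2 : 𝓞 k) ∉ l → Q.s ∉ l → ∀ z : 𝓞 k,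
        z ^ 2 - ε * Q.s ∈ l → ((Ideal.absNorm l : ℕ) : ZMod p) ^ ((p - 1) / 4) = 1 := by
  have hpp : p.Prime := Fact.out
  obtain ⟨A, B, hAB, ⟨A', rfl⟩, ⟨B', rfl⟩, hcrit⟩ := exists_sq_add_sq_quartic_criterion hp
  obtain ⟨T, hT⟩ : ∃ T, T = Q.ω + (A' : 𝓞 k) := ⟨_, rfl⟩
  have hT2 : 2 * T = (2 * A' + 1 : ℤ) + Q.s := by
    push_cast
    linear_combination Q.two_mul_ω + 2 * hT
  obtain ⟨T', hT'⟩ : ∃ T', T' = Q.ω - (A' + 1 : 𝓞 k) := ⟨_, rfl⟩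
  have hT2' : 2 * T' = Q.s - (2 * A' + 1 : ℤ) := by
    push_cast
    linear_combination Q.two_mul_ω + 2 * hT'
  have h2 : (2 : 𝓞 k) ≠ 0 := two_ne_zero
  have hsum : T + T' = Q.s := by linear_combination Q.two_mul_ω + hT + hT'
  have hABk : ((2 * A' + 1 : ℤ) : 𝓞 k) ^ 2 + ((B' + B' : ℤ) : 𝓞 k) ^ 2 = Q.s ^ 2 := by
    rw [Q.s_sq]
    exact_mod_cast congrArg (Int.cast : ℤ → 𝓞 k) hAB
  have hprod : T * T' = (B' : 𝓞 k) ^ 2 := by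
    apply mul_left_cancel₀ (mul_ne_zero h2 h2)
    push_cast at hABk hT2 hT2'
    linear_combination 2 * T' * hT2 + (2 * A' + 1 + Q.s) * hT2' - hABk
  have hστ : Q.τ.σ T = -T' := by
    apply mul_left_cancel₀ h2
    have h3 := congrArg Q.τ.σ hT2
    rw [map_mul, map_add Q.τ.σ _ Q.s, map_ofNat, Q.apply_s, map_intCast] at h3
    linear_combination h3 + hT2'
  have hcop : IsCoprime T T' := by
    have h3 : IsCoprime (2 * A' + 1) (p : ℤ) := by
      rw [isCoprime_comm, (Nat.prime_iff_prime_int.mp hpp).irreducible.coprime_iff_not_dvd]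
      rintro ⟨m, hm⟩
      rw [hm] at hAB
      have hm0 : m ≠ 0 := by
        rintro rfl
        omega
      have h3 : 0 < m ^ 2 := by positivity
      have h4 : (1 : ℤ) < p := by exact_mod_cast hpp.one_lt
      nlinarith [sq_nonneg (B' + B'), mul_pos (by linarith : (0 : ℤ) < p) h3]
    obtain ⟨u, v, huv⟩ := h3
    have h4 : (u : 𝓞 k) * (2 * A' + 1 : ℤ) + v * p = 1 := by
      exact_mod_cast congrArg (Int.cast : ℤ → 𝓞 k) huv
    rw [← Q.s_sq] at h4
    refine ⟨u + v * Q.s, -u + v * Q.s, ?_⟩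
    have h5 : T - T' = (2 * A' + 1 : ℤ) := by
      rw [hT, hT']
      push_cast
      ring
    linear_combination h4 + u * h5 + v * Q.s * hsum
  obtain ⟨J, hJ⟩ : ∃ J : Ideal (𝓞 k), Ideal.span {T} = J ^ 2 := by
    refine exists_eq_pow_of_mul_eq_pow (b := Ideal.span {T'}) (c := Ideal.span {(B' : 𝓞 k)}) ?_ ?_
    · rw [isUnit_iff_eq_one, ← Ideal.isCoprime_iff_gcd, Ideal.isCoprime_span_singleton_iff]
      exact hcop
    · rw [Ideal.span_singleton_mul_span_singleton, hprod, Ideal.span_singleton_pow]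
  obtain ⟨c, hc⟩ := exists_pow_classNumber_eq_span J
  set h := classNumber k
  obtain ⟨j, hj⟩ : Odd h := Q.odd_classNumber
  obtain ⟨ε, hε⟩ : ∃ ε : (𝓞 k)ˣ, c ^ 2 * ε = T ^ h := by
    refine Ideal.span_singleton_eq_span_singleton.mp ?_
    rw [← Ideal.span_singleton_pow, ← Ideal.span_singleton_pow, ← hc, hJ, ← pow_mul, ← pow_mul,
      mul_comm]
  have hTneg : Q.ι (T : 𝓞 k) < 0 := by
    have h3 : 2 * Q.ι (T : 𝓞 k) = (2 * A' + 1 : ℤ) + Q.ι Q.s := by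
      have := congrArg (Q.ι.comp (algebraMap (𝓞 k) k)) hT2
      rw [map_mul, map_add, map_ofNat, map_intCast] at this
      exact this
    have h4 : Q.ι Q.s ^ 2 = p := by
      have := congrArg (Q.ι.comp (algebraMap (𝓞 k) k)) Q.s_sq
      rw [map_pow, map_natCast] at this
      exact this
    have h5 : ((2 * A' + 1 : ℤ) : ℝ) ^ 2 < Q.ι Q.s ^ 2 := by
      rw [h4]
      have h6 : (2 * A' + 1) ^ 2 ≠ (p : ℤ) := fun h7 => by
        have h8 : IsSquare (p : ℤ) := ⟨2 * A' + 1, by rw [← h7, pow_two]⟩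
        exact (Nat.prime_iff_prime_int.mp hpp).not_isSquare h8
      have h7 : (2 * A' + 1) ^ 2 < (p : ℤ) := lt_of_le_of_ne (by nlinarith [sq_nonneg (B' + B')]) h6
      exact_mod_cast h7
    rw [sq_lt_sq, abs_of_neg Q.ι_s] at h5
    linarith [le_abs_self ((2 * A' + 1 : ℤ) : ℝ)]
  have hT0 : T ≠ 0 := by
    intro h0
    rw [h0] at hTneg
    simp at hTneg
  have hειneg : Q.ι (ε : 𝓞 k) < 0 := by
    have h3 := congrArg (fun x : 𝓞 k => Q.ι (x : k)) hε
    simp only [map_mul, map_pow] at h3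
    have h4 : Q.ι (T : 𝓞 k) ^ h < 0 := Odd.pow_neg ⟨j, hj⟩ hTneg
    rw [← h3] at h4
    by_contra hcon
    push Not at hcon
    exact absurd h4 (not_lt.mpr (mul_nonneg (sq_nonneg _) hcon))
  have hσT : Q.τ.σ c ^ 2 * Q.τ.σ ε = -T' ^ h := by
    rw [← map_pow, ← map_mul, hε, map_pow, hστ, Odd.neg_pow ⟨j, hj⟩]
  have hεN : (ε : 𝓞 k) * Q.τ.σ ε = -1 := by
    have h1 : IsUnit (Algebra.norm ℤ (ε : 𝓞 k)) := ε.isUnit.map _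
    rw [← Q.norm_eq]
    rcases Int.isUnit_iff.mp h1 with h3 | h3
    · exfalso
      have h4 := Q.norm_eq ε
      rw [h3, Int.cast_one] at h4
      have h5 : (Algebra.norm ℤ c) ^ 2 + (B' ^ h) ^ 2 = 0 := by
        have : (((Algebra.norm ℤ c) ^ 2 + (B' ^ h) ^ 2 : ℤ) : 𝓞 k) = 0 := by
          push_cast
          rw [Q.norm_eq, ← pow_mul, mul_comm h 2, pow_mul, ← hprod, mul_pow]
          linear_combination -T' ^ h * hε + c ^ 2 * ε * hσT + c ^ 2 * Q.τ.σ c ^ 2 * h4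
        exact_mod_cast this
      have h6 : Algebra.norm ℤ c = 0 := by
        nlinarith [sq_nonneg (Algebra.norm ℤ c), sq_nonneg (B' ^ h)]
      rw [Algebra.norm_eq_zero_iff] at h6
      rw [h6] at hε
      exact pow_ne_zero h hT0 (by rw [← hε]; ring)
    · rw [h3]
      simp
  refine ⟨ε, hεN, hειneg, ?_⟩
  intro l hl h2l hsl z hz
  let F := 𝓞 k ⧸ l
  let _ : Field F := Ideal.Quotient.field l
  have : Finite F := Ideal.finiteQuotientOfFreeOfNeBot l
    (Ring.ne_bot_of_isMaximal_of_not_isField hl (RingOfIntegers.not_isField k))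
  let _ : Fintype F := Fintype.ofFinite F
  let π : 𝓞 k →+* F := Ideal.Quotient.mk l
  have hπ : ∀ x, π x = 0 ↔ x ∈ l := fun x => Ideal.Quotient.eq_zero_iff_mem
  have hcard : Ideal.absNorm l = Fintype.card F := by
    rw [Ideal.absNorm_apply, Submodule.cardQuot_apply, Nat.card_eq_fintype_card]
  have hz' : π z ^ 2 = π ε * π Q.s := by
    rw [← sub_eq_zero, ← map_pow, ← map_mul, ← map_sub, hπ]
    exact hz
  have hs0 : π Q.s ≠ 0 := fun h0 => hsl ((hπ _).mp h0)
  have h20 : (2 : F) ≠ 0 := fun h0 => h2l ((hπ _).mp (by rwa [map_ofNat]))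
  have hε0 : π ε ≠ 0 := (ε.isUnit.map π).ne_zero
  have hss : π Q.s ^ 2 = p := by rw [← map_pow, Q.s_sq, map_natCast]
  have hz0 : π z ≠ 0 := fun h0 => mul_ne_zero hε0 hs0 (by rw [← hz', h0]; ring)
  have key : ∀ t d : F, t ≠ 0 → t ^ h = π ε * d ^ 2 →
      ∃ y ≠ 0, y ^ 2 = 2 * π Q.s * (2 * t) := by
    intro t d ht htd
    have hd : d ≠ 0 := by
      rintro rfl
      exact pow_ne_zero h ht (by rw [htd]; ring)
    refine ⟨2 * (π z * d / t ^ j), mul_ne_zero h20 (div_ne_zero (mul_ne_zero hz0 hd)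
      (pow_ne_zero _ ht)), ?_⟩
    rw [hj, pow_succ, mul_comm 2 j, pow_mul] at htd
    field_simp
    linear_combination d ^ 2 * hz' - π Q.s * htd
  rw [hcard]
  have hp0 : (p : F) ≠ 0 := by
    rw [← hss]
    exact pow_ne_zero 2 hs0
  by_cases hTl : π T = 0
  · have hT'l : π T' ≠ 0 := fun h0 => hs0 (by rw [← hsum, map_add, hTl, h0, add_zero])
    obtain ⟨y, hy, hy2⟩ := key (π T') (π (Q.τ.σ ε * Q.τ.σ c)) hT'l (by
      rw [← map_pow, ← map_pow, ← map_mul]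
      congr 1
      linear_combination hσT - Q.τ.σ ε * Q.τ.σ c ^ 2 * hεN)
    refine hcrit F h20 hp0 (π Q.s) y hss hy (Or.inr ?_)
    rw [hy2, ← map_ofNat π 2, ← map_mul π 2 T', hT2', map_sub, map_intCast]
  · obtain ⟨y, hy, hy2⟩ := key (π T) (π c) hTl (by
      rw [← map_pow, ← map_pow, ← map_mul, ← hε, mul_comm])
    refine hcrit F h20 hp0 (π Q.s) y hss hy (Or.inl ?_)
    rw [hy2, ← map_ofNat π 2, ← map_mul π 2 T, hT2, map_add, map_intCast, add_comm]

end RealQuadratic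

/-- Reduction at a rational prime: an ideal of norm `p` is the kernel of a map to `ZMod p`. -/
theorem Ideal.exists_ker_eq_of_absNorm_eq {p : ℕ} [Fact p.Prime] {L : Type*} [Field L]
    [NumberField L] {I : Ideal (𝓞 L)} (h : Ideal.absNorm I = p) :
    ∃ φ : 𝓞 L →+* ZMod p, RingHom.ker φ = I := by
  have hcard : Nat.card (𝓞 L ⧸ I) = p := by
    rw [← h, Ideal.absNorm_apply]
    rfl
  have hfin : Finite (𝓞 L ⧸ I) := Nat.finite_of_card_ne_zero (by
    rw [hcard]
    exact (Fact.out : p.Prime).ne_zero)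
  have := Fintype.ofFinite (𝓞 L ⧸ I)
  rw [Nat.card_eq_fintype_card] at hcard
  refine ⟨(ZMod.ringEquivOfPrime (𝓞 L ⧸ I) Fact.out hcard).symm.toRingHom.comp
    (Ideal.Quotient.mk I), ?_⟩
  ext x
  simp [RingHom.mem_ker, Ideal.Quotient.eq_zero_iff_mem]

/-- An involution acts trivially modulo a prime element that it negates. -/
theorem FixedInvolution.map_apply_eq {A B F : Type*} [CommRing A] [IsDomain A] [CommRing B]
    [IsDomain B] [Algebra A B] (τ : FixedInvolution A B) [CommRing F] [IsDomain F]
    (f : B →+* F) {a : B} {s : A}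
    (hinj : Function.Injective (algebraMap A B)) (hs : Prime s) (ha : a ^ 2 = algebraMap A B s)
    (hσ : τ.σ a = -a) (hfs : f (algebraMap A B s) = 0) (x : B) : f (τ.σ x) = f x := by
  obtain ⟨y, hy⟩ : ∃ y, y = x - τ.σ x := ⟨_, rfl⟩
  have hσy : τ.σ y = -y := by rw [hy, map_sub, τ.apply_apply]; ring
  obtain ⟨c, hc⟩ := τ.exists_of_fixed (a * y) (by rw [map_mul, hσ, hσy]; ring)
  obtain ⟨d, hd⟩ := τ.exists_of_fixed (y ^ 2) (by rw [map_pow, hσy]; ring)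
  have h1 : c ^ 2 = s * d := hinj (by rw [map_pow, map_mul, hc, hd, ← ha]; ring)
  obtain ⟨c', rfl⟩ : s ∣ c := hs.dvd_of_dvd_pow ⟨d, h1⟩
  have h2 : d = s * c' ^ 2 := mul_left_cancel₀ hs.ne_zero (by rw [← h1]; ring)
  have h3 : f y ^ 2 = 0 := by
    rw [← map_pow, ← hd, h2, map_mul, map_mul, hfs, zero_mul]
  have h4 : f y = 0 := by simpa using h3
  rw [hy, map_sub, sub_eq_zero] at h4
  exact h4.symm

/-- The field `K = ℚ(α)` with `α ^ 4 = p` over its quadratic subfield `k = ℚ(√p)`. -/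
structure QuarticTower (p : ℕ) (k K : Type) [Field k] [NumberField k] [Field K] [NumberField K]
    [Algebra k K] where
  Q : RealQuadratic p k
  α : 𝓞 K
  τ : FixedInvolution (𝓞 k) (𝓞 K)
  ι : K →+* ℝ
  α_sq : α ^ 2 = algebraMap (𝓞 k) (𝓞 K) Q.s
  apply_α : τ.σ α = -α
  norm_eq : ∀ x, algebraMap (𝓞 k) (𝓞 K) (Algebra.intNorm (𝓞 k) (𝓞 K) x) = x * τ.σ x
  finrank_eq : Module.finrank ℚ K = 4
  relfinrank_eq : Module.finrank (𝓞 k) (𝓞 K) = 2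

namespace QuarticTower

variable {p : ℕ} {k K : Type} [Field k] [NumberField k] [Field K] [NumberField K]
    [Algebra k K] (T : QuarticTower p k K)

theorem α_ne_zero [Fact p.Prime] : T.α ≠ 0 := fun h => by
  have := T.α_sq
  rw [h, zero_pow two_ne_zero, eq_comm, FaithfulSMul.algebraMap_eq_zero_iff] at this
  exact T.Q.s_ne_zero this

theorem intNorm_α : Algebra.intNorm (𝓞 k) (𝓞 K) T.α = -T.Q.s := by
  apply RingOfIntegers.algebraMap.injective k K
  rw [T.norm_eq, T.apply_α, map_neg, ← T.α_sq]
  ring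

theorem absNorm_span_α [Fact p.Prime] : Ideal.absNorm (Ideal.span {T.α}) = p := by
  rw [← Ideal.absNorm_relNorm (𝓞 k) (𝓞 K), Ideal.relNorm_singleton, T.intNorm_α,
    Ideal.span_singleton_neg, T.Q.absNorm_span_s]

theorem isPrime_span_α [Fact p.Prime] : (Ideal.span {T.α}).IsPrime :=
  Ideal.isPrime_of_irreducible_absNorm (by
    rw [T.absNorm_span_α]
    exact (Fact.out : p.Prime))

/-- The residue map at the prime `(α)`. -/
noncomputable def φ [Fact p.Prime] : 𝓞 K →+* ZMod p :=
  (Ideal.exists_ker_eq_of_absNorm_eq T.absNorm_span_α).choose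

theorem φ_eq_zero_iff [Fact p.Prime] {x : 𝓞 K} : T.φ x = 0 ↔ T.α ∣ x := by
  rw [← RingHom.mem_ker, φ, (Ideal.exists_ker_eq_of_absNorm_eq T.absNorm_span_α).choose_spec,
    Ideal.mem_span_singleton]

/-- The residue map at the prime `(√p)`. -/
noncomputable def ψ [Fact p.Prime] : 𝓞 k →+* ZMod p :=
  T.φ.comp (algebraMap (𝓞 k) (𝓞 K))

theorem φ_algebraMap [Fact p.Prime] (x : 𝓞 k) : T.φ (algebraMap _ _ x) = T.ψ x := rfl

theorem ψ_s [Fact p.Prime] : T.ψ T.Q.s = 0 := by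
  rw [← φ_algebraMap, φ_eq_zero_iff, ← T.α_sq]
  exact dvd_pow_self _ two_ne_zero

theorem ψ_apply [Fact p.Prime] (x : 𝓞 k) : T.ψ (T.Q.τ.σ x) = T.ψ x := by
  refine T.Q.τ.map_apply_eq T.ψ (a := T.Q.s) (s := p) (FaithfulSMul.algebraMap_injective _ _)
    (Nat.prime_iff_prime_int.mp Fact.out) ?_ T.Q.apply_s ?_ x
  · rw [T.Q.s_sq]
    simp
  · simp

theorem φ_apply [Fact p.Prime] (x : 𝓞 K) : T.φ (T.τ.σ x) = T.φ x :=
  T.τ.map_apply_eq T.φ (RingOfIntegers.algebraMap.injective k K) T.Q.prime_s T.α_sq T.apply_α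
    (by rw [φ_algebraMap, ψ_s]) x

theorem ψ_eq_zero_iff [Fact p.Prime] {x : 𝓞 k} : T.ψ x = 0 ↔ T.Q.s ∣ x := by
  constructor
  · intro h
    have hmax := T.Q.isPrime_span_s.isMaximal (by simpa using T.Q.s_ne_zero)
    have h1 : Ideal.span {T.Q.s} = RingHom.ker T.ψ :=
      hmax.eq_of_le (RingHom.ker_ne_top _)
        (by rw [Ideal.span_singleton_le_iff_mem]; exact T.ψ_s)
    rwa [← Ideal.mem_span_singleton, h1]
  · rintro ⟨c, rfl⟩
    rw [map_mul, ψ_s, zero_mul]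

theorem natCast_absNorm_span [Fact p.Prime] (n : 𝓞 k) :
    ((Ideal.absNorm (Ideal.span {n}) : ℕ) : ZMod p) = T.ψ n ^ 2 ∨
      ((Ideal.absNorm (Ideal.span {n}) : ℕ) : ZMod p) = -T.ψ n ^ 2 := by
  have h1 : ((Algebra.norm ℤ n : ℤ) : ZMod p) = T.ψ n ^ 2 := by
    have := congrArg T.ψ (T.Q.norm_eq n)
    rw [map_mul, ψ_apply, map_intCast] at this
    rw [this, pow_two]
  rw [Ideal.absNorm_span_singleton]
  rcases Int.natAbs_eq (Algebra.norm ℤ n) with h | h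
  · left
    rw [← h1]
    conv_rhs => rw [h]
    simp
  · right
    rw [← h1]
    conv_rhs => rw [h]
    simp

theorem ψ_intNorm [Fact p.Prime] (x : 𝓞 K) :
    T.ψ (Algebra.intNorm (𝓞 k) (𝓞 K) x) = T.φ x ^ 2 := by
  rw [← φ_algebraMap, T.norm_eq, map_mul, φ_apply, pow_two]

/-- Reduction modulo `p` of the quartic residue character. -/
def quarticChar (p : ℕ) : ℕ →* ZMod p where
  toFun n := (n : ZMod p) ^ ((p - 1) / 4)
  map_one' := by simp
  map_mul' m n := by push_cast; rw [mul_pow]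

theorem quarticChar_apply (n : ℕ) : quarticChar p n = (n : ZMod p) ^ ((p - 1) / 4) := rfl

theorem quarticChar_absNorm_span (hp8 : p % 8 = 1) [Fact p.Prime] (n : 𝓞 k) :
    quarticChar p (Ideal.absNorm (Ideal.span {n})) = T.ψ n ^ ((p - 1) / 2) := by
  rw [quarticChar_apply, show (p - 1) / 2 = 2 * ((p - 1) / 4) by omega, pow_mul]
  rcases T.natCast_absNorm_span n with h | h
  · rw [h]
  · rw [h, Even.neg_pow]
    exact ⟨(p - 1) / 8, by omega⟩

theorem quarticChar_absNorm_span_eq_one (hp8 : p % 8 = 1) [Fact p.Prime] {x : 𝓞 K}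
    (hx : ¬ T.α ∣ x) : quarticChar p (Ideal.absNorm (Ideal.span {x})) = 1 := by
  rw [← Ideal.absNorm_relNorm (𝓞 k) (𝓞 K), Ideal.relNorm_singleton,
    T.quarticChar_absNorm_span hp8, ψ_intNorm, ← pow_mul,
    show 2 * ((p - 1) / 2) = p - 1 by omega]
  exact ZMod.pow_card_sub_one_eq_one (by rwa [Ne, φ_eq_zero_iff])

end QuarticTower

theorem Ideal.comap_eq_of_map_le {A B : Type*} [CommRing A] [IsDedekindDomain A] [CommRing B]
    [Algebra A B] {p : Ideal A} [p.IsPrime] (hp : p ≠ ⊥) {P : Ideal B} [P.IsPrime]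
    (h : p.map (algebraMap A B) ≤ P) : P.comap (algebraMap A B) = p := by
  have hm : p.IsMaximal := Ideal.IsPrime.isMaximal inferInstance hp
  refine (hm.eq_of_le (Ideal.comap_ne_top _ (Ideal.IsPrime.ne_top inferInstance)) ?_).symm
  rwa [← Ideal.map_le_iff_le_comap]

namespace RealQuadratic

variable {p : ℕ} {k : Type} [Field k] [NumberField k] (Q : RealQuadratic p k)

theorem exists_ω_sq_eq (hp16 : p % 16 = 9) : ∃ r : ℕ, Q.ω ^ 2 = Q.ω + 2 * (2 * r + 1) := by
  refine ⟨p / 16, ?_⟩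
  have hp : (p : 𝓞 k) = 16 * (p / 16 : ℕ) + 9 := by
    have : p = 16 * (p / 16) + 9 := by omega
    exact_mod_cast congrArg (Nat.cast : ℕ → 𝓞 k) this
  obtain ⟨r, hr⟩ : ∃ r : 𝓞 k, r = (p / 16 : ℕ) := ⟨_, rfl⟩
  have hs := Q.s_sq
  rw [hp, ← hr] at hs
  rw [← hr]
  have h4 : (4 : 𝓞 k) ≠ 0 := by norm_num
  apply mul_left_cancel₀ h4
  linear_combination (2 * Q.ω + Q.s - 1) * Q.two_mul_ω + hs

theorem absNorm_span_two (Q : RealQuadratic p k) : Ideal.absNorm (Ideal.span {(2 : 𝓞 k)}) = 4 := by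
  have h1 : Algebra.norm ℤ (2 : 𝓞 k) = 4 := by
    have h2 := Q.norm_eq 2
    rw [map_ofNat Q.τ.σ] at h2
    have h3 : ((Algebra.norm ℤ (2 : 𝓞 k) : ℤ) : 𝓞 k) = ((4 : ℤ) : 𝓞 k) := by
      rw [h2]; norm_num
    exact Int.cast_injective h3
  rw [Ideal.absNorm_span_singleton, h1]
  rfl

theorem absNorm_span_two_ω (hp16 : p % 16 = 9) :
    Ideal.absNorm (Ideal.span {2, Q.ω}) = 2 := by
  obtain ⟨r, hr⟩ := Q.exists_ω_sq_eq hp16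
  have hσω : Q.τ.σ Q.ω = 1 - Q.ω := by
    have := Q.ω_sub_apply
    linear_combination Q.two_mul_ω - this
  have hmul : Ideal.span {2, Q.ω} * Ideal.span {2, 1 - Q.ω} = Ideal.span {(2 : 𝓞 k)} := by
    rw [Ideal.span_pair_mul_span_pair]
    apply le_antisymm
    · rw [Ideal.span_le]
      rintro x (rfl | rfl | rfl | rfl) <;> rw [SetLike.mem_coe, Ideal.mem_span_singleton']
      · exact ⟨2, rfl⟩
      · exact ⟨1 - Q.ω, by ring⟩
      · exact ⟨Q.ω, rfl⟩
      · exact ⟨-(2 * r + 1), by linear_combination hr⟩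
    · rw [Ideal.span_singleton_le_iff_mem]
      have h1 : 2 * (1 - Q.ω) + Q.ω * 2 ∈
          Ideal.span {2 * 2, 2 * (1 - Q.ω), Q.ω * 2, Q.ω * (1 - Q.ω)} :=
        Ideal.add_mem _ (Ideal.subset_span (by simp)) (Ideal.subset_span (by simp))
      rwa [show 2 * (1 - Q.ω) + Q.ω * 2 = 2 by ring] at h1
  have hmap : (Ideal.span {2, Q.ω}).map (Q.τ.σ : 𝓞 k →+* 𝓞 k) = Ideal.span {2, 1 - Q.ω} := by
    rw [Ideal.map_span, Set.image_pair]
    simp [hσω, map_ofNat Q.τ.σ 2]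
  have hmap' : (Ideal.span {2, 1 - Q.ω}).map (Q.τ.σ : 𝓞 k →+* 𝓞 k) = Ideal.span {2, Q.ω} := by
    rw [Ideal.map_span, Set.image_pair]
    simp [hσω, map_ofNat Q.τ.σ 2]
  have hnorm := Q.absNorm_span_two
  have hne : Ideal.span {2, Q.ω} ≠ ⊤ := by
    intro h
    rw [← hmul, ← hmap, h, Ideal.map_top, Ideal.top_mul, Ideal.absNorm_top] at hnorm
    omega
  have hne' : Ideal.span {2, 1 - Q.ω} ≠ ⊤ := by
    intro h
    apply hne
    rw [← hmap', h, Ideal.map_top]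
  rw [← hmul, map_mul] at hnorm
  rw [Ne, ← Ideal.absNorm_eq_one_iff] at hne hne'
  obtain ⟨a, ha⟩ : ∃ a, a = Ideal.absNorm (Ideal.span {2, Q.ω}) := ⟨_, rfl⟩
  rw [← ha] at hnorm hne ⊢
  have h1 : a ∣ 2 ^ 2 := ⟨_, hnorm.symm⟩
  rw [Nat.dvd_prime_pow Nat.prime_two] at h1
  obtain ⟨i, hi, rfl⟩ := h1
  interval_cases i
  · simp at hne
  · rfl
  · omega

theorem isPrime_span_two_ω (hp16 : p % 16 = 9) : (Ideal.span {2, Q.ω}).IsPrime :=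
  Ideal.isPrime_of_irreducible_absNorm (by
    rw [Q.absNorm_span_two_ω hp16]
    exact Nat.prime_two)

end RealQuadratic

namespace QuarticTower

variable {p : ℕ} {k K : Type} [Field k] [NumberField k] [Field K] [NumberField K]
    [Algebra k K] (T : QuarticTower p k K)

theorem ι_pos_of_norm [Fact p.Prime] {x : 𝓞 K} (hx : x ≠ 0) {n : 𝓞 k}
    (hn : algebraMap (𝓞 k) (𝓞 K) n = x * T.τ.σ x) : 0 < T.Q.ι n := by
  obtain ⟨U, hU⟩ := T.τ.exists_trace x
  obtain ⟨V, hV⟩ := T.τ.exists_of_fixed (T.α * (x - T.τ.σ x)) (by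
    rw [map_mul, map_sub, T.apply_α, T.τ.apply_apply]; ring)
  have h1 : 4 * T.Q.s * n = T.Q.s * U ^ 2 - V ^ 2 := by
    apply RingOfIntegers.algebraMap.injective k K
    rw [map_sub, map_mul, map_mul, map_mul, map_pow, map_pow, hn, hU, hV, ← T.α_sq, map_ofNat]
    ring
  have h2 := congrArg (T.Q.ι.comp (algebraMap (𝓞 k) k)) h1
  rw [map_sub, map_mul, map_mul, map_mul, map_pow, map_pow, map_ofNat] at h2
  change 4 * T.Q.ι T.Q.s * T.Q.ι n = T.Q.ι T.Q.s * T.Q.ι U ^ 2 - T.Q.ι V ^ 2 at h2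
  have hn0 : T.Q.ι n ≠ 0 := by
    rw [Ne, map_eq_zero, RingOfIntegers.coe_eq_zero_iff]
    rintro rfl
    rw [map_zero, eq_comm, mul_eq_zero] at hn
    rcases hn with h | h
    · exact hx h
    · exact hx (by simpa using h)
  have hs := T.Q.ι_s
  by_contra hcon
  have hneg : T.Q.ι n < 0 := lt_of_le_of_ne (not_lt.mp hcon) hn0
  nlinarith [mul_pos_of_neg_of_neg hs hneg, mul_nonneg (neg_nonneg.mpr hs.le) (sq_nonneg (T.Q.ι U)),
    sq_nonneg (T.Q.ι V)]

theorem span_sq_eq_map (hp16 : p % 16 = 9) :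
    (Ideal.span {2, algebraMap (𝓞 k) (𝓞 K) T.Q.ω, 1 + T.α}) ^ 2 =
      (Ideal.span {2, T.Q.ω}).map (algebraMap (𝓞 k) (𝓞 K)) := by
  obtain ⟨r, hr⟩ := T.Q.exists_ω_sq_eq hp16
  have hr' := congrArg (algebraMap (𝓞 k) (𝓞 K)) hr
  have h2ω := congrArg (algebraMap (𝓞 k) (𝓞 K)) T.Q.two_mul_ω
  simp only [map_pow, map_add, map_mul, map_ofNat, map_one, map_natCast, ← T.α_sq] at hr' h2ω
  rw [Ideal.map_span, Set.image_pair, map_ofNat]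
  obtain ⟨w, hw⟩ : ∃ w, w = algebraMap (𝓞 k) (𝓞 K) T.Q.ω := ⟨_, rfl⟩
  rw [← hw] at hr' h2ω ⊢
  have hsq : (1 + T.α) ^ 2 = 2 * w + 2 * T.α := by linear_combination -h2ω
  apply le_antisymm
  · have h2 : (2 : 𝓞 K) ∈ Ideal.span {2, w} := Ideal.subset_span (by simp)
    have hwm : w ∈ Ideal.span {2, w} := Ideal.subset_span (by simp)
    rw [pow_two, Ideal.span_mul_span', Ideal.span_le, Set.mul_subset_iff]
    rintro x hx y hy
    rw [SetLike.mem_coe]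
    by_cases hx' : x = 1 + T.α
    · by_cases hy' : y = 1 + T.α
      · rw [hx', hy', ← pow_two, hsq]
        exact Ideal.add_mem _ (Ideal.mul_mem_right _ _ h2) (Ideal.mul_mem_right _ _ h2)
      · apply Ideal.mul_mem_left
        rcases hy with rfl | rfl | rfl
        exacts [h2, hwm, (hy' rfl).elim]
    · apply Ideal.mul_mem_right
      rcases hx with rfl | rfl | rfl
      exacts [h2, hwm, (hx' rfl).elim]
  · obtain ⟨I, hI⟩ : ∃ I, I = Ideal.span {2, w, 1 + T.α} := ⟨_, rfl⟩
    have h2 : (2 : 𝓞 K) ∈ I := hI ▸ Ideal.subset_span (by simp)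
    have hwm : w ∈ I := hI ▸ Ideal.subset_span (by simp)
    have ham : 1 + T.α ∈ I := hI ▸ Ideal.subset_span (by simp)
    rw [← hI]
    have h2m : (2 : 𝓞 K) ∈ I ^ 2 := by
      have : (2 : 𝓞 K) = 2 * (1 + T.α) - (1 + T.α) * (1 + T.α) + 2 * w := by
        linear_combination hsq
      rw [this, pow_two]
      exact Ideal.add_mem _ (Ideal.sub_mem _ (Ideal.mul_mem_mul h2 ham)
        (Ideal.mul_mem_mul ham ham)) (Ideal.mul_mem_mul h2 hwm)
    rw [Ideal.span_le]
    rintro x (rfl | rfl)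
    · exact h2m
    · have : x = x * x - 2 * (2 * r + 1) := by linear_combination -hr'
      rw [SetLike.mem_coe, this]
      refine Ideal.sub_mem _ ?_ (Ideal.mul_mem_right _ _ h2m)
      rw [pow_two]
      exact Ideal.mul_mem_mul hwm hwm

theorem exists_two_mul_eq (hp16 : p % 16 = 9) :
    ∃ γ : 𝓞 K, 2 * γ = algebraMap (𝓞 k) (𝓞 K) T.Q.ω * (1 + T.α) := by
  obtain ⟨r, hr⟩ := T.Q.exists_ω_sq_eq hp16
  have hr' := congrArg (algebraMap (𝓞 k) (𝓞 K)) hr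
  have h2ω := congrArg (algebraMap (𝓞 k) (𝓞 K)) T.Q.two_mul_ω
  simp only [map_pow, map_add, map_mul, map_ofNat, map_one, map_natCast, ← T.α_sq] at hr' h2ω
  obtain ⟨w, hw⟩ : ∃ w, w = algebraMap (𝓞 k) (𝓞 K) T.Q.ω := ⟨_, rfl⟩
  rw [← hw] at hr' h2ω ⊢
  have hr2 := congrArg (algebraMap (𝓞 K) K) hr'
  have h2 := congrArg (algebraMap (𝓞 K) K) h2ω
  simp only [map_pow, map_add, map_mul, map_ofNat, map_one, map_natCast] at hr2 h2
  obtain ⟨v, hv⟩ : ∃ v, v = (2 * (r : 𝓞 K) + 1) * w := ⟨_, rfl⟩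
  have hv2 := congrArg (algebraMap (𝓞 K) K) hv
  simp only [map_add, map_mul, map_ofNat, map_one, map_natCast] at hv2
  have hInt : IsIntegral (𝓞 K) ((algebraMap (𝓞 K) K w * (1 + algebraMap (𝓞 K) K T.α)) / 2) := by
    refine ⟨Polynomial.X ^ 2 - (Polynomial.C w * Polynomial.X +
      Polynomial.C v), ?_, ?_⟩
    · exact Polynomial.monic_X_pow_sub (by compute_degree; norm_num)
    · simp only [Polynomial.eval₂_sub, Polynomial.eval₂_add, Polynomial.eval₂_pow,
        Polynomial.eval₂_mul, Polynomial.eval₂_X, Polynomial.eval₂_C, hv2]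
      obtain ⟨W, hW⟩ : ∃ W, W = algebraMap (𝓞 K) K w := ⟨_, rfl⟩
      obtain ⟨a, ha⟩ : ∃ a, a = algebraMap (𝓞 K) K T.α := ⟨_, rfl⟩
      rw [← hW] at hr2 h2 ⊢
      rw [← ha] at h2 ⊢
      field_simp
      linear_combination (-W ^ 2) * h2 + 2 * W * hr2
  obtain ⟨γ, hγ⟩ := IsIntegrallyClosed.isIntegral_iff.mp hInt
  refine ⟨γ, RingOfIntegers.coe_injective ?_⟩
  rw [map_mul, hγ, map_ofNat, map_mul, map_add, map_one]
  field_simp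

theorem eq_mul_map_of_sq_eq_map [Fact p.Prime] (hp16 : p % 16 = 9) {D : Ideal (𝓞 k)} (hD : D ≠ ⊥)
    {I : Ideal (𝓞 K)} (h : I ^ 2 = D.map (algebraMap (𝓞 k) (𝓞 K))) :
    ∃ (a b : ℕ) (J : Ideal (𝓞 k)),
      I = Ideal.span {2, algebraMap (𝓞 k) (𝓞 K) T.Q.ω, 1 + T.α} ^ a * Ideal.span {T.α} ^ b *
        J.map (algebraMap (𝓞 k) (𝓞 K)) := by
  have hinj := RingOfIntegers.algebraMap.injective k K
  refine FixedInvolution.induction_of_sq_eq_map hinj (C := fun I => ∃ (a b : ℕ) (J : Ideal (𝓞 k)),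
      I = Ideal.span {2, algebraMap (𝓞 k) (𝓞 K) T.Q.ω, 1 + T.α} ^ a * Ideal.span {T.α} ^ b *
        J.map (algebraMap (𝓞 k) (𝓞 K))) ?_ ?_ ?_ D hD I h
  · intro J
    exact ⟨0, 0, J, by simp⟩
  · rintro _ _ ⟨a, b, J, rfl⟩ ⟨a', b', J', rfl⟩
    refine ⟨a + a', b + b', J * J', ?_⟩
    rw [Ideal.map_mul]
    ring
  · intro q hq hq0
    have hqmax := hq.isMaximal hq0
    by_cases hsq : T.Q.s ∈ q
    · refine Or.inl ⟨Ideal.span {T.α}, ⟨0, 1, ⊤, by simp [Ideal.map_top]⟩, ?_⟩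
      have hmax := T.Q.isPrime_span_s.isMaximal (by simpa using T.Q.s_ne_zero)
      rw [← hmax.eq_of_le hq.ne_top (by rwa [Ideal.span_singleton_le_iff_mem]), Ideal.map_span,
        Set.image_singleton, Ideal.span_singleton_pow, T.α_sq]
    by_cases hω : 2 ∈ q ∧ T.Q.ω ∈ q
    · refine Or.inl ⟨_, ⟨1, 0, ⊤, by rw [Ideal.map_top, pow_one, pow_zero, mul_one, Ideal.mul_top]⟩,
        ?_⟩
      have hmax := (T.Q.isPrime_span_two_ω hp16).isMaximal (by
        intro h
        have := T.Q.absNorm_span_two_ω hp16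
        rw [h, Ideal.absNorm_bot] at this
        omega)
      rw [T.span_sq_eq_map hp16, hmax.eq_of_le hq.ne_top]
      rw [Ideal.span_le]
      rintro x (rfl | rfl)
      exacts [hω.1, hω.2]
    right
    constructor
    · obtain ⟨P, hP, h1⟩ := Ideal.exists_ideal_over_prime_of_isIntegral (S := 𝓞 K) q ⊥ (by
        rw [Ideal.comap_bot_of_injective _ hinj]
        exact bot_le)
      exact ⟨P, h1.1, Ideal.map_le_iff_le_comap.mpr h1.2.ge⟩
    · intro P hP hdvd
      have hle : q.map (algebraMap (𝓞 k) (𝓞 K)) ≤ P :=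
        (Ideal.le_of_dvd hdvd).trans (Ideal.pow_le_self two_ne_zero)
      have hcomap := Ideal.comap_eq_of_map_le hq0 hle
      have hmem : ∀ x, algebraMap (𝓞 k) (𝓞 K) x ∈ P ↔ x ∈ q := fun x => by
        rw [← Ideal.mem_comap, hcomap]
      have hαP : T.α ∉ P := fun hα => hsq (by
        rw [← hmem, ← T.α_sq]
        exact P.pow_mem_of_mem hα 2 two_pos)
      by_cases h2 : 2 ∈ q
      · obtain ⟨γ, hγ⟩ := T.exists_two_mul_eq hp16
        have hγσ : γ - T.τ.σ γ = algebraMap (𝓞 k) (𝓞 K) T.Q.ω * T.α := by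
          have h3 := congrArg T.τ.σ hγ
          rw [map_mul, map_mul, map_add, T.apply_α, map_one, map_ofNat, T.τ.apply_algebraMap] at h3
          apply mul_left_cancel₀ (two_ne_zero : (2 : 𝓞 K) ≠ 0)
          linear_combination hγ - h3
        refine T.τ.not_sq_dvd_map hq0 hinj (y := γ) ?_ hdvd
        rw [hγσ]
        intro h3
        rcases hP.mem_or_mem h3 with h3 | h3
        · exact hω ⟨h2, (hmem _).mp h3⟩
        · exact hαP h3
      · refine T.τ.not_sq_dvd_map hq0 hinj (y := T.α) ?_ hdvd
        rw [T.apply_α, show T.α - -T.α = algebraMap (𝓞 k) (𝓞 K) 2 * T.α by rw [map_ofNat]; ring]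
        intro h3
        rcases hP.mem_or_mem h3 with h3 | h3
        · exact h2 ((hmem _).mp h3)
        · exact hαP h3

theorem absNorm_map_algebraMap (T : QuarticTower p k K) (I : Ideal (𝓞 k)) :
    Ideal.absNorm (I.map (algebraMap (𝓞 k) (𝓞 K))) = Ideal.absNorm I ^ 2 := by
  rw [← Ideal.absNorm_relNorm (𝓞 k) (𝓞 K), Ideal.relNorm_algebraMap, T.relfinrank_eq, map_pow]

/-- The ramified prime of `K` above `2`; together with `(α)` and the ideals of `k`
it generates the ideals whose square comes from `k`. -/
structure RamifiedTwo (T : QuarticTower p k K) where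
  ideal : Ideal (𝓞 K)
  absNorm_eq : Ideal.absNorm ideal = 2
  exists_sq_eq : ∃ q : Ideal (𝓞 k), ideal ^ 2 = q.map (algebraMap (𝓞 k) (𝓞 K))
  exists_eq_mul : ∀ D : Ideal (𝓞 k), D ≠ ⊥ → ∀ I, I ^ 2 = D.map (algebraMap (𝓞 k) (𝓞 K)) →
    ∃ (a b : ℕ) (J : Ideal (𝓞 k)),
      I = ideal ^ a * Ideal.span {T.α} ^ b * J.map (algebraMap (𝓞 k) (𝓞 K))

theorem RamifiedTwo.nonempty [Fact p.Prime] (hp16 : p % 16 = 9) (T : QuarticTower p k K) :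
    Nonempty T.RamifiedTwo := by
  refine ⟨⟨_, ?_, ⟨_, T.span_sq_eq_map hp16⟩, fun D hD I h => T.eq_mul_map_of_sq_eq_map hp16 hD h⟩⟩
  have h := congrArg Ideal.absNorm (T.span_sq_eq_map hp16)
  rw [T.absNorm_map_algebraMap, map_pow, T.Q.absNorm_span_two_ω hp16] at h
  exact Nat.pow_left_injective two_ne_zero h

end QuarticTower

/-- The form `X ^ 2 - d * Y ^ 2` is anisotropic at primes modulo which `d` is not a square. -/
theorem Ideal.mem_pow_of_sq_sub_mul_sq_mem {R : Type*} [CommRing R] [IsDedekindDomain R]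
    {l : Ideal R} (hl : l.IsMaximal) (hl0 : l ≠ ⊥) {d : R} (hd : ∀ z, z ^ 2 - d ∉ l) (m : ℕ)
    {X Y : R} (h : X ^ 2 - d * Y ^ 2 ∈ l ^ (2 * m)) : X ∈ l ^ m ∧ Y ∈ l ^ m := by
  have hlp : Prime l := (Ideal.prime_iff_isPrime hl0).mpr hl.isPrime
  have hcancel : ∀ (a b : R) (n : ℕ), a ∉ l → a * b ∈ l ^ n → b ∈ l ^ n := by
    intro a b n ha hab
    rw [← Ideal.dvd_span_singleton] at ha hab ⊢
    rw [← Ideal.span_singleton_mul_span_singleton] at hab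
    exact hlp.pow_dvd_of_dvd_mul_left n ha hab
  have hbase : ∀ X Y : R, X ^ 2 - d * Y ^ 2 ∈ l → X ∈ l ∧ Y ∈ l := by
    intro X Y h
    have hY : Y ∈ l := by
      by_contra hY
      obtain ⟨a, i, hi, hai⟩ := hl.exists_inv hY
      apply hd (a * X)
      have h1 : (a * X) ^ 2 - d = a ^ 2 * (X ^ 2 - d * Y ^ 2) - d * (a * Y + 1) * i := by
        linear_combination (d * (a * Y + 1)) * hai
      rw [h1]
      exact l.sub_mem (l.mul_mem_left _ h) (l.mul_mem_left _ hi)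
    refine ⟨hl.isPrime.mem_of_pow_mem 2 ?_, hY⟩
    have : X ^ 2 = (X ^ 2 - d * Y ^ 2) + d * Y * Y := by ring
    rw [this]
    exact l.add_mem h (l.mul_mem_left _ hY)
  induction m generalizing X Y with
  | zero => simp
  | succ m ih =>
    obtain ⟨hX, hY⟩ := hbase X Y (Ideal.pow_le_self (by omega) h)
    have hlt : l ^ 2 < l := by
      simpa using Ideal.pow_right_strictAnti l hl0 hl.ne_top one_lt_two
    obtain ⟨π, hπ, hπ2⟩ := SetLike.exists_of_lt hlt
    obtain ⟨M, hM⟩ := Ideal.dvd_span_singleton.mpr hπ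
    have hlM : ¬ l ∣ M := by
      rintro ⟨N, rfl⟩
      apply hπ2
      rw [← Ideal.dvd_span_singleton, hM]
      exact ⟨N, by ring⟩
    obtain ⟨c, hcM, hcl⟩ := SetLike.not_le_iff_exists.mp (mt Ideal.dvd_iff_le.mpr hlM)
    have hdiv : ∀ x ∈ l, ∃ x', c * x = x' * π := by
      intro x hx
      have : c * x ∈ Ideal.span {π} := by
        rw [hM, mul_comm c]
        exact Ideal.mul_mem_mul hx hcM
      obtain ⟨x', hx'⟩ := Ideal.mem_span_singleton'.mp this
      exact ⟨x', hx'.symm⟩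
    obtain ⟨X', hX'⟩ := hdiv X hX
    obtain ⟨Y', hY'⟩ := hdiv Y hY
    have h2 : X' ^ 2 - d * Y' ^ 2 ∈ l ^ (2 * m) := by
      have h3 : (X' ^ 2 - d * Y' ^ 2) * (π * π) = (X ^ 2 - d * Y ^ 2) * c ^ 2 := by
        linear_combination (-(c * X) - X' * π) * hX' + d * (c * Y + Y' * π) * hY'
      have h4 : l ^ (2 * (m + 1)) ∣ Ideal.span {(X' ^ 2 - d * Y' ^ 2) * (π * π)} := by
        rw [Ideal.dvd_span_singleton, h3]
        exact Ideal.mul_mem_right _ _ h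
      rw [← Ideal.span_singleton_mul_span_singleton, ← Ideal.span_singleton_mul_span_singleton,
        hM, show 2 * (m + 1) = 2 * m + 2 by ring, pow_add,
        show Ideal.span {X' ^ 2 - d * Y' ^ 2} * (l * M * (l * M)) =
          (M * M * Ideal.span {X' ^ 2 - d * Y' ^ 2}) * l ^ 2 by ring] at h4
      have h5 := (mul_dvd_mul_iff_right (pow_ne_zero 2 hlp.ne_zero)).mp h4
      rw [← Ideal.dvd_span_singleton]
      exact hlp.pow_dvd_of_dvd_mul_left _ (fun h => (hlp.dvd_or_dvd h).elim hlM hlM) h5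
    obtain ⟨h6, h7⟩ := ih h2
    constructor
    · refine hcancel c X _ hcl ?_
      rw [hX', pow_succ]
      exact Ideal.mul_mem_mul h6 hπ
    · refine hcancel c Y _ hcl ?_
      rw [hY', pow_succ]
      exact Ideal.mul_mem_mul h7 hπ

/-- A multiplicative function is trivial at `I` as soon as it is at each primary component. -/
theorem Ideal.map_eq_one_of_forall_prime {R M : Type*} [CommRing R] [IsDedekindDomain R]
    [CommMonoid M] (f : Ideal R →* M) {I : Ideal R} (hI : I ≠ ⊥)
    (h : ∀ l : Ideal R, l.IsMaximal → l ≠ ⊥ → l ∣ I → ∀ n,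
      l ^ n ∣ I → ¬ l ^ (n + 1) ∣ I → f l ^ n = 1) :
    f I = 1 := by
  classical
  have h1 := Ideal.prod_normalizedFactors_eq_self hI
  rw [← h1, Finset.prod_multiset_count, map_prod]
  refine Finset.prod_eq_one fun l hl => ?_
  rw [map_pow]
  have hl1 := Multiset.mem_toFinset.mp hl
  have hlp := UniqueFactorizationMonoid.prime_of_normalized_factor l hl1
  have hem := UniqueFactorizationMonoid.emultiplicity_eq_count_normalizedFactors
    hlp.irreducible hI
  rw [normalize_eq] at hem
  refine h l ((Ideal.isPrime_of_prime hlp).isMaximal hlp.ne_zero) hlp.ne_zero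
    (UniqueFactorizationMonoid.dvd_of_mem_normalizedFactors hl1) _ ?_ ?_
  · exact pow_dvd_of_le_emultiplicity hem.ge
  · rw [pow_dvd_iff_le_emultiplicity, hem]
    norm_cast
    omega

/-- A unit of norm `-1`, positive where `√p` is negative, such that the primes modulo which
`-η√p` is a square have trivial quartic symbol. -/
structure SpecialUnit {p : ℕ} {k : Type} [Field k] [NumberField k] (Q : RealQuadratic p k) where
  η : (𝓞 k)ˣ
  mul_apply : (η : 𝓞 k) * Q.τ.σ η = -1
  ι_pos : 0 < Q.ι (η : 𝓞 k)
  quarticChar_eq_one : ∀ l : Ideal (𝓞 k), l.IsMaximal → 2 ∉ l → Q.s ∉ l →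
    ∀ z, z ^ 2 + η * Q.s ∈ l → QuarticTower.quarticChar p (Ideal.absNorm l) = 1

namespace SpecialUnit

variable {p : ℕ} {k : Type} [Field k] [NumberField k] {Q : RealQuadratic p k}

theorem nonempty [Fact p.Prime] (hp8 : p % 8 = 1) (Q : RealQuadratic p k) :
    Nonempty (SpecialUnit Q) := by
  obtain ⟨ε, h1, h2, h3⟩ := Q.exists_unit_absNorm_pow_eq_one hp8
  refine ⟨⟨-ε, ?_, ?_, fun l hl h2l hsl z hz => h3 l hl h2l hsl z ?_⟩⟩
  · simpa using h1
  · simpa using h2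
  · simpa [sub_eq_add_neg] using hz

theorem ne_sq (E : SpecialUnit Q) (v : (𝓞 k)ˣ) : E.η ≠ v ^ 2 ∧ E.η ≠ -v ^ 2 := by
  have key : ∀ x : 𝓞 k, x ^ 2 ≠ -1 := by
    intro x hx
    have := congrArg (Q.ι.comp (algebraMap (𝓞 k) k)) hx
    rw [map_pow, map_neg, map_one] at this
    nlinarith [sq_nonneg (Q.ι.comp (algebraMap (𝓞 k) k) x)]
  have h := E.mul_apply
  constructor
  · intro hv
    rw [hv] at h
    apply key (v * Q.τ.σ v)
    rw [← h]
    push_cast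
    rw [map_pow]
    ring
  · intro hv
    rw [hv] at h
    apply key (v * Q.τ.σ v)
    rw [← h]
    push_cast
    rw [map_neg, map_pow]
    ring

theorem eq_sq_or_eq_mul_sq [Fact p.Prime] (E : SpecialUnit Q) {u : (𝓞 k)ˣ}
    (hu : 0 < Q.ι (u : 𝓞 k)) : ∃ v : (𝓞 k)ˣ, u = v ^ 2 ∨ u = E.η * v ^ 2 := by
  obtain ⟨v, hv⟩ := Units.eq_sq_mul_of_rank_eq_one Q.ι
    (Units.rank_eq_one_of_finrank_eq_two Q.ι Q.finrank_eq) E.ne_sq u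
  have hpos : 0 < Q.ι ((v : 𝓞 k) : k) ^ 2 := by
    rw [sq_pos_iff, Ne, map_eq_zero, RingOfIntegers.coe_eq_zero_iff]
    exact v.ne_zero
  refine ⟨v, ?_⟩
  rcases hv with h | h | h | h
  · exact Or.inl h
  · exfalso
    rw [h] at hu
    simp only [Units.val_neg, Units.val_pow_eq_pow_val, map_neg, map_pow] at hu
    linarith
  · exact Or.inr h
  · exfalso
    rw [h] at hu
    simp only [Units.val_neg, Units.val_mul, Units.val_pow_eq_pow_val, map_neg, map_mul,
      map_pow] at hu
    nlinarith [mul_pos E.ι_pos hpos]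

theorem ψ_η_sq {K : Type} [Field K] [NumberField K] [Algebra k K] [Fact p.Prime]
    {T : QuarticTower p k K} (E : SpecialUnit T.Q) : T.ψ E.η ^ 2 = -1 := by
  have := congrArg T.ψ E.mul_apply
  rwa [map_mul, T.ψ_apply, map_neg, map_one, ← pow_two] at this

end SpecialUnit

namespace QuarticTower

variable {p : ℕ} {k K : Type} [Field k] [NumberField k] [Field K] [NumberField K]
    [Algebra k K] (T : QuarticTower p k K)

theorem quarticChar_sq [Fact p.Prime] (T : QuarticTower p k K) (hp8 : p % 8 = 1) {I : Ideal (𝓞 k)}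
    (hI : ¬ p ∣ Ideal.absNorm I) : quarticChar p (Ideal.absNorm I) ^ 2 = 1 := by
  obtain ⟨c, hc⟩ := exists_pow_classNumber_eq_span I
  obtain ⟨j, hj⟩ := T.Q.odd_classNumber
  have hI0 : ((Ideal.absNorm I : ℕ) : ZMod p) ≠ 0 := by
    rwa [Ne, ZMod.natCast_eq_zero_iff]
  have h4 : quarticChar p (Ideal.absNorm I) ^ 4 = 1 := by
    rw [quarticChar_apply, ← pow_mul, show (p - 1) / 4 * 4 = p - 1 by omega]
    exact ZMod.pow_card_sub_one_eq_one hI0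
  have h1 : quarticChar p (Ideal.absNorm I) ^ (2 * classNumber k) = 1 := by
    rw [mul_comm, pow_mul, ← map_pow, ← map_pow Ideal.absNorm, hc, T.quarticChar_absNorm_span hp8,
      ← pow_mul,
      show (p - 1) / 2 * 2 = p - 1 by omega]
    apply ZMod.pow_card_sub_one_eq_one
    intro h0
    apply pow_ne_zero (classNumber k) hI0
    rw [← Nat.cast_pow, ← map_pow, hc]
    rcases T.natCast_absNorm_span c with h | h <;> rw [h, h0] <;> simp
  rwa [hj, show 2 * (2 * j + 1) = 4 * j + 2 by ring, pow_add, pow_mul, h4, one_pow, one_mul] at h1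

theorem quarticChar_sq' [Fact p.Prime] (T : QuarticTower p k K) (hp8 : p % 8 = 1) {I : Ideal (𝓞 K)}
    (hI : ¬ p ∣ Ideal.absNorm I) : quarticChar p (Ideal.absNorm I) ^ 2 = 1 := by
  rw [← Ideal.absNorm_relNorm (𝓞 k) (𝓞 K)] at hI ⊢
  exact T.quarticChar_sq hp8 hI

theorem dvd_of_map_dvd_map (T : QuarticTower p k K) {I J : Ideal (𝓞 k)}
    (h : I.map (algebraMap (𝓞 k) (𝓞 K)) ∣ J.map (algebraMap (𝓞 k) (𝓞 K))) : I ∣ J := by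
  obtain ⟨M, hM⟩ := h
  have h1 := congrArg (Ideal.relNorm (𝓞 k)) hM
  rw [map_mul, Ideal.relNorm_algebraMap, Ideal.relNorm_algebraMap, T.relfinrank_eq] at h1
  exact (UniqueFactorizationMonoid.pow_dvd_pow_iff_dvd two_ne_zero).mp ⟨_, h1⟩

theorem squarefree_map {l : Ideal (𝓞 k)} (hl : l.IsMaximal) (hl0 : l ≠ ⊥) (h2 : 2 ∉ l)
    (hs : T.Q.s ∉ l) : Squarefree (l.map (algebraMap (𝓞 k) (𝓞 K))) := by
  have hinj := RingOfIntegers.algebraMap.injective k K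
  have hlp := hl.isPrime
  rw [squarefree_iff_irreducible_sq_not_dvd_of_ne_zero
    (by rwa [Ne, Ideal.zero_eq_bot, Ideal.map_eq_bot_iff_of_injective hinj])]
  intro P hP
  have hPp := Ideal.isPrime_of_prime hP.prime
  rw [← pow_two]
  intro hdvd
  have hcomap := Ideal.comap_eq_of_map_le hl0
    ((Ideal.le_of_dvd hdvd).trans (Ideal.pow_le_self two_ne_zero))
  refine T.τ.not_sq_dvd_map hl0 hinj (y := T.α) ?_ hdvd
  rw [T.apply_α, show T.α - -T.α = algebraMap (𝓞 k) (𝓞 K) 2 * T.α by rw [map_ofNat]; ring]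
  intro h
  rcases hPp.mem_or_mem h with h | h
  · rw [← Ideal.mem_comap, hcomap] at h
    exact h2 h
  · apply hs
    rw [← hcomap, Ideal.mem_comap, ← T.α_sq]
    exact P.pow_mem_of_mem h 2 two_pos

end QuarticTower

namespace QuarticTower

variable {p : ℕ} {k K : Type} [Field k] [NumberField k] [Field K] [NumberField K]
    [Algebra k K] (T : QuarticTower p k K)

theorem absNorm_sq_eq {b : Ideal (𝓞 K)} {x : 𝓞 K} {n : 𝓞 k} (T : QuarticTower p k K)
    (hb : b ^ 2 = Ideal.span {x}) (hx : x * T.τ.σ x = algebraMap _ _ n) :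
    Ideal.absNorm b ^ 2 = Ideal.absNorm (Ideal.span {n}) := by
  have h1 : Algebra.intNorm (𝓞 k) (𝓞 K) x = n :=
    RingOfIntegers.algebraMap.injective k K (by rw [T.norm_eq, hx])
  rw [← map_pow, hb, ← Ideal.absNorm_relNorm (𝓞 k) (𝓞 K), Ideal.relNorm_singleton, h1]

theorem not_dvd_of_sq_eq_span [Fact p.Prime] {b : Ideal (𝓞 K)} {x : 𝓞 K}
    (hb : b ^ 2 = Ideal.span {x}) (hpb : ¬ p ∣ Ideal.absNorm b) : ¬ T.α ∣ x := by
  rintro ⟨c, rfl⟩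
  apply hpb
  apply (Fact.out : p.Prime).dvd_of_dvd_pow (n := 2)
  rw [← map_pow, hb, ← Ideal.span_singleton_mul_span_singleton, map_mul, T.absNorm_span_α]
  exact dvd_mul_right _ _

/-- The trace of a generator of `b ^ 2` has even valuation at the primes modulo which
`-η√p` is not a square. -/
theorem even_of_pow_dvd_trace [Fact p.Prime] (η : 𝓞 k) {b : Ideal (𝓞 K)} {x : 𝓞 K}
    (hb : b ^ 2 = Ideal.span {x}) {w U : 𝓞 k}
    (hx : x * T.τ.σ x = algebraMap _ _ (η * w ^ 2))
    (hU : algebraMap _ _ U = x + T.τ.σ x) {l : Ideal (𝓞 k)} (hl : l.IsMaximal) (hl0 : l ≠ ⊥)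
    (h2 : 2 ∉ l) (hs : T.Q.s ∉ l) (hz : ∀ z, z ^ 2 + η * T.Q.s ∉ l) {n : ℕ}
    (hn : l ^ n ∣ Ideal.span {U}) (hn1 : ¬ l ^ (n + 1) ∣ Ideal.span {U}) : Even n := by
  by_contra hodd
  rw [Nat.not_even_iff_odd] at hodd
  obtain ⟨j, hj⟩ := hodd
  obtain ⟨V, hV⟩ := T.τ.exists_of_fixed (T.α * (x - T.τ.σ x)) (by
    rw [map_mul, map_sub, T.apply_α, T.τ.apply_apply]; ring)
  have hUV : V ^ 2 - (-(η * T.Q.s)) * (2 * w) ^ 2 = T.Q.s * U ^ 2 := by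
    apply RingOfIntegers.algebraMap.injective k K
    simp only [map_mul, map_pow, map_sub, map_neg, map_ofNat, hV, hU, ← T.α_sq] at hx ⊢
    linear_combination (-4 * T.α ^ 2) * hx
  rw [Ideal.dvd_span_singleton] at hn
  have hVn : V ∈ l ^ n := by
    refine (Ideal.mem_pow_of_sq_sub_mul_sq_mem hl hl0 (d := -(η * T.Q.s))
      (fun z => by rw [sub_neg_eq_add]; exact hz z) n (Y := 2 * w) ?_).1
    rw [hUV, mul_comm 2 n, pow_mul]
    exact Ideal.mul_mem_left _ _ (Ideal.pow_mem_pow hn 2)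
  have hxn : x ∈ (l ^ n).map (algebraMap (𝓞 k) (𝓞 K)) := by
    have h1 : algebraMap (𝓞 k) (𝓞 K) (2 * T.Q.s) * x ∈ (l ^ n).map (algebraMap (𝓞 k) (𝓞 K)) := by
      have : algebraMap (𝓞 k) (𝓞 K) (2 * T.Q.s) * x =
          algebraMap _ _ T.Q.s * algebraMap _ _ U + T.α * algebraMap _ _ V := by
        rw [map_mul, map_ofNat, hU, hV, ← T.α_sq]
        ring
      rw [this]
      exact Ideal.add_mem _ (Ideal.mul_mem_left _ _ (Ideal.mem_map_of_mem _ hn))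
        (Ideal.mul_mem_left _ _ (Ideal.mem_map_of_mem _ hVn))
    have h2s : 2 * T.Q.s ∉ l := fun h => (hl.isPrime.mem_or_mem h).elim h2 hs
    have h3 : l ^ n ⊔ Ideal.span {2 * T.Q.s} = ⊤ := by
      refine Ideal.pow_sup_eq_top ?_
      exact (Ideal.isMaximal_def.mp hl).2 _ (by
        rwa [left_lt_sup, Ideal.span_singleton_le_iff_mem])
    obtain ⟨a, ha, c, hc, hac⟩ := Submodule.mem_sup.mp ((Ideal.eq_top_iff_one _).mp h3)
    obtain ⟨e, rfl⟩ := Ideal.mem_span_singleton'.mp hc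
    have h4 : x = x * algebraMap _ _ a +
        algebraMap _ _ e * (algebraMap (𝓞 k) (𝓞 K) (2 * T.Q.s) * x) := by
      have := congrArg (algebraMap (𝓞 k) (𝓞 K)) hac
      rw [map_add, map_mul, map_one] at this
      linear_combination (-x) * this
    rw [h4]
    exact Ideal.add_mem _ (Ideal.mul_mem_left _ _ (Ideal.mem_map_of_mem _ ha))
      (Ideal.mul_mem_left _ _ h1)
  have hsqf := T.squarefree_map hl hl0 h2 hs
  have hxn1 : x ∈ (l ^ (n + 1)).map (algebraMap (𝓞 k) (𝓞 K)) := by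
    rw [← Ideal.dvd_span_singleton, ← hb, Ideal.map_pow] at hxn ⊢
    obtain ⟨L, hL⟩ : ∃ L, L = l.map (algebraMap (𝓞 k) (𝓞 K)) := ⟨_, rfl⟩
    rw [← hL] at hxn hsqf ⊢
    have hL0 : L ≠ 0 := hsqf.ne_zero
    have h1 : L ^ j ∣ b := by
      rw [← UniqueFactorizationMonoid.pow_dvd_pow_iff_dvd two_ne_zero, ← pow_mul]
      exact (pow_dvd_pow L (by omega)).trans hxn
    obtain ⟨c, rfl⟩ := h1
    rw [hj, pow_succ, mul_comm 2 j, pow_mul, mul_pow,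
      mul_dvd_mul_iff_left (pow_ne_zero 2 (pow_ne_zero j hL0)), hsqf.dvd_pow_iff_dvd two_ne_zero]
      at hxn
    rw [show n + 1 = (j + 1) * 2 by omega, pow_mul, pow_succ]
    exact pow_dvd_pow_of_dvd (mul_dvd_mul_left _ hxn) 2
  apply hn1
  apply T.dvd_of_map_dvd_map
  rw [Ideal.map_span, Set.image_singleton, Ideal.dvd_span_singleton, hU]
  exact Ideal.add_mem _ hxn1 (T.τ.apply_mem_map hxn1)

/-- The trace of a generator of `b ^ 2` of norm `η □` has trivial quartic symbol. -/
theorem quarticChar_trace [Fact p.Prime] (hp16 : p % 16 = 9) (E : SpecialUnit T.Q)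
    (h2 : quarticChar p 2 = 1) {b : Ideal (𝓞 K)} {x : 𝓞 K}
    (hb : b ^ 2 = Ideal.span {x}) {w U : 𝓞 k}
    (hx : x * T.τ.σ x = algebraMap _ _ (E.η * w ^ 2)) (hU : algebraMap _ _ U = x + T.τ.σ x)
    (hU0 : T.ψ U ≠ 0) : quarticChar p (Ideal.absNorm (Ideal.span {U})) = 1 := by
  have hp8 : p % 8 = 1 := by omega
  refine Ideal.map_eq_one_of_forall_prime ((quarticChar p).comp
    (Ideal.absNorm (S := 𝓞 k) : Ideal (𝓞 k) →* ℕ)) ?_ ?_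
  · rw [Ne, Ideal.span_singleton_eq_bot]
    rintro rfl
    exact hU0 (map_zero _)
  intro l hl hl0 hlU n hn hn1
  rw [MonoidHom.comp_apply, MonoidHom.coe_coe]
  have hsl : T.Q.s ∉ l := by
    intro hs
    have hmax := T.Q.isPrime_span_s.isMaximal (by simpa using T.Q.s_ne_zero)
    rw [← hmax.eq_of_le hl.ne_top (by rwa [Ideal.span_singleton_le_iff_mem]),
      Ideal.dvd_span_singleton, Ideal.mem_span_singleton] at hlU
    exact hU0 (T.ψ_eq_zero_iff.mpr hlU)
  by_cases h2l : 2 ∈ l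
  · have h4 : Ideal.absNorm l ∣ 2 ^ 2 := by
      have := map_dvd Ideal.absNorm (Ideal.dvd_span_singleton.mpr h2l)
      rwa [T.Q.absNorm_span_two] at this
    obtain ⟨i, -, hi⟩ := (Nat.dvd_prime_pow Nat.prime_two).mp h4
    rw [hi, map_pow, h2, one_pow, one_pow]
  by_cases hz : ∃ z, z ^ 2 + E.η * T.Q.s ∈ l
  · obtain ⟨z, hz⟩ := hz
    rw [E.quarticChar_eq_one l hl h2l hsl z hz, one_pow]
  push Not at hz
  obtain ⟨j, rfl⟩ := T.even_of_pow_dvd_trace E.η hb hx hU hl hl0 h2l hsl hz hn hn1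
  rw [← two_mul, pow_mul, T.quarticChar_sq hp8, one_pow]
  intro hpl
  have hU' := map_dvd Ideal.absNorm hlU
  apply hU0
  have h3 : ((Ideal.absNorm (Ideal.span {U}) : ℕ) : ZMod p) = 0 :=
    (ZMod.natCast_eq_zero_iff _ _).mpr (hpl.trans hU')
  rcases T.natCast_absNorm_span U with h | h <;> rw [h3] at h
  · simpa using h.symm
  · simpa using h.symm

/-- If `b ^ 2` is generated by an element of norm `η □`, then `b` has nontrivial quartic symbol,
provided that `2` is a quartic residue. -/
theorem quarticChar_ne_one_of_norm_eq [Fact p.Prime] (hp16 : p % 16 = 9) (E : SpecialUnit T.Q)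
    (h2 : quarticChar p 2 = 1) {b : Ideal (𝓞 K)} {x : 𝓞 K}
    (hb : b ^ 2 = Ideal.span {x}) (hpb : ¬ p ∣ Ideal.absNorm b) {w : 𝓞 k}
    (hx : x * T.τ.σ x = algebraMap _ _ (E.η * w ^ 2)) : quarticChar p (Ideal.absNorm b) ≠ 1 := by
  have hp8 : p % 8 = 1 := by omega
  have hαx := T.not_dvd_of_sq_eq_span hb hpb
  have hφx : T.φ x ≠ 0 := by rwa [Ne, T.φ_eq_zero_iff]
  obtain ⟨U, hU⟩ := T.τ.exists_trace x
  have h2p : (2 : ZMod p) ≠ 0 := by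
    intro h
    rw [quarticChar_apply, Nat.cast_ofNat, h, zero_pow (by omega)] at h2
    exact zero_ne_one h2
  have hψU : T.ψ U = 2 * T.φ x := by
    rw [← T.φ_algebraMap, hU, map_add, T.φ_apply, two_mul]
  have hU1 := T.quarticChar_trace hp16 E h2 hb hx hU (by
    rw [hψU]
    exact mul_ne_zero h2p hφx)
  have hN : Ideal.absNorm b = Ideal.absNorm (Ideal.span {w}) := by
    have h := T.absNorm_sq_eq hb hx
    rw [← Ideal.span_singleton_mul_span_singleton, ← Ideal.span_singleton_pow,
      Ideal.span_singleton_eq_top.mpr E.η.isUnit, Ideal.top_mul, map_pow] at h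
    exact Nat.pow_left_injective two_ne_zero h
  have hφ2 : T.φ x ^ 2 = T.ψ E.η * T.ψ w ^ 2 := by
    have := congrArg T.φ hx
    rwa [map_mul, T.φ_apply, ← pow_two, T.φ_algebraMap, map_mul, map_pow] at this
  have hη : T.ψ E.η ^ ((p - 1) / 4) = -1 := by
    rw [show (p - 1) / 4 = 2 * (2 * (p / 16) + 1) by omega, pow_mul, E.ψ_η_sq]
    exact Odd.neg_one_pow ⟨_, rfl⟩
  rw [T.quarticChar_absNorm_span hp8, hψU, show (p - 1) / 2 = 2 * ((p - 1) / 4) by omega,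
    pow_mul, mul_pow, hφ2, mul_pow, mul_pow, hη, ← pow_mul, mul_comm 2 ((p - 1) / 4),
    pow_mul] at hU1
  have h2' : (2 : ZMod p) ^ ((p - 1) / 4) = 1 := by
    simpa [quarticChar_apply] using h2
  rw [h2', one_pow, one_mul, ← pow_mul, show 2 * ((p - 1) / 4) = (p - 1) / 2 by omega,
    ← T.quarticChar_absNorm_span hp8, ← hN] at hU1
  intro h
  rw [h, mul_one] at hU1
  apply h2p
  linear_combination (-1 : ZMod p) * hU1

end QuarticTower

theorem SpecialUnit.exists_pow_eq_sq_mul {p : ℕ} {k K : Type} [Field k] [NumberField k] [Field K]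
    [NumberField K] [Algebra k K] {T : QuarticTower p k K} [Fact p.Prime] (E : SpecialUnit T.Q)
    (hE : ∀ (v : (𝓞 K)ˣ) (f : (𝓞 k)ˣ), (v : 𝓞 K) * T.τ.σ v ≠ algebraMap _ _ (E.η * f ^ 2 : 𝓞 k))
    (v : (𝓞 K)ˣ) : ∃ (f : (𝓞 k)ˣ), (v : 𝓞 K) * T.τ.σ v = algebraMap _ _ ((f : 𝓞 k) ^ 2) := by
  have hu : IsUnit (Algebra.intNorm (𝓞 k) (𝓞 K) (v : 𝓞 K)) := v.isUnit.map _
  obtain ⟨n, hn⟩ := hu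
  have hnv : algebraMap (𝓞 k) (𝓞 K) n = v * T.τ.σ v := by rw [hn, T.norm_eq]
  obtain ⟨f, hf⟩ := E.eq_sq_or_eq_mul_sq (T.ι_pos_of_norm v.ne_zero hnv)
  rcases hf with rfl | rfl
  · exact ⟨f, by rw [← hnv, Units.val_pow_eq_pow_val]⟩
  · exact absurd (by rw [← hnv, Units.val_mul, Units.val_pow_eq_pow_val]) (hE v f)

namespace QuarticTower

variable {p : ℕ} {k K : Type} [Field k] [NumberField k] [Field K] [NumberField K]
    [Algebra k K] {T : QuarticTower p k K}

theorem RamifiedTwo.pow_classNumber (R : T.RamifiedTwo) {D : Ideal (𝓞 k)} (hD : D ≠ ⊥)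
    {I : Ideal (𝓞 K)} (hI : I ^ 2 = D.map (algebraMap (𝓞 k) (𝓞 K))) :
    ∃ (b : ℕ) (c : 𝓞 k), I ^ classNumber k = Ideal.span {T.α ^ b * algebraMap _ _ c} ∨
      I ^ classNumber k = R.ideal ^ classNumber k * Ideal.span {T.α ^ b * algebraMap _ _ c} := by
  obtain ⟨a, b, J, rfl⟩ := R.exists_eq_mul D hD I hI
  obtain ⟨c, hc⟩ := exists_pow_classNumber_eq_span J
  obtain ⟨q, hq⟩ := R.exists_sq_eq
  obtain ⟨r, hr⟩ := exists_pow_classNumber_eq_span q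
  have hr' : (R.ideal ^ 2) ^ classNumber k = Ideal.span {algebraMap (𝓞 k) (𝓞 K) r} := by
    rw [hq, ← Ideal.map_pow, hr, Ideal.map_span, Set.image_singleton]
  have hc' : J.map (algebraMap (𝓞 k) (𝓞 K)) ^ classNumber k =
      Ideal.span {algebraMap (𝓞 k) (𝓞 K) c} := by
    rw [← Ideal.map_pow, hc, Ideal.map_span, Set.image_singleton]
  have key : ∀ i, (R.ideal ^ (2 * i)) ^ classNumber k * (Ideal.span {T.α} ^ b) ^ classNumber k *
      J.map (algebraMap (𝓞 k) (𝓞 K)) ^ classNumber k =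
      Ideal.span {T.α ^ (b * classNumber k) * algebraMap _ _ (r ^ i * c)} := by
    intro i
    rw [hc', pow_mul, pow_right_comm, hr', Ideal.span_singleton_pow, Ideal.span_singleton_pow,
      Ideal.span_singleton_pow, Ideal.span_singleton_mul_span_singleton,
      Ideal.span_singleton_mul_span_singleton, map_mul, map_pow]
    congr 2
    ring
  rcases Nat.even_or_odd' a with ⟨i, rfl | rfl⟩
  · exact ⟨_, _, Or.inl (by rw [mul_pow, mul_pow, key i])⟩
  · refine ⟨_, _, Or.inr (by rw [mul_pow, mul_pow, ← key i]; ring)⟩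

/-- Either the class of the ramified prime above `2` has odd order, or there is a unit
of norm `η □`. -/
theorem RamifiedTwo.isPrincipal_or_exists_unit [Fact p.Prime] (R : T.RamifiedTwo)
    (E : SpecialUnit T.Q) : (∃ z, R.ideal ^ classNumber k = Ideal.span {z}) ∨
      ∃ (v : (𝓞 K)ˣ) (f : (𝓞 k)ˣ), (v : 𝓞 K) * T.τ.σ v = algebraMap _ _ (E.η * f ^ 2 : 𝓞 k) := by
  by_contra! hcon
  obtain ⟨hQ, hE⟩ := hcon
  obtain ⟨F, hF⟩ : ∃ F : (𝓞 k)ˣ →* (𝓞 K)ˣ, F = Units.map (algebraMap (𝓞 k) (𝓞 K)) := ⟨_, rfl⟩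
  have hF' : ∀ f : (𝓞 k)ˣ, algebraMap (𝓞 k) (𝓞 K) f = F f := fun f => by rw [hF]; rfl
  obtain ⟨v, hv⟩ := Units.exists_ne_sq_mul T.ι (F E.η)
    (Units.two_le_rank_of_finrank_eq_four T.ι T.finrank_eq)
  obtain ⟨f, hf⟩ := E.exists_pow_eq_sq_mul hE v
  obtain ⟨u, hu⟩ : ∃ u : (𝓞 K)ˣ, u = v * F f⁻¹ := ⟨_, rfl⟩
  have huv : v = u * F f := by rw [hu, mul_assoc, ← map_mul, inv_mul_cancel, map_one, mul_one]
  have hunorm : (u : 𝓞 K) * T.τ.σ u = 1 := by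
    rw [huv, Units.val_mul, map_mul, ← hF', T.τ.apply_algebraMap, map_pow, hF'] at hf
    apply mul_right_cancel₀ (pow_ne_zero 2 (F f).ne_zero)
    linear_combination hf
  obtain ⟨y, hy0, hyu, d, hd, hyd⟩ := T.τ.exists_eq_mul_apply T.α_ne_zero T.apply_α hunorm
  obtain ⟨b, c, hbc⟩ := R.pow_classNumber (by simpa using hd) hyd
  obtain ⟨j, hj⟩ := T.Q.odd_classNumber
  have hu2 : ∃ t : (𝓞 K)ˣ, u = t ^ 2 ∨ u = -t ^ 2 := by
    rw [Ideal.span_singleton_pow] at hbc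
    have hyh : y ^ classNumber k ≠ 0 := pow_ne_zero _ hy0
    rcases hbc with h | h
    · obtain ⟨u', hu'⟩ := Ideal.span_singleton_eq_span_singleton.mp h.symm
      obtain ⟨f', hf'⟩ := E.exists_pow_eq_sq_mul hE u'
      rw [map_pow, hF'] at hf'
      have hne : T.α ^ b * algebraMap (𝓞 k) (𝓞 K) c ≠ 0 := by
        intro h0
        rw [h0, zero_mul] at hu'
        exact hyh hu'.symm
      have h1 : (u : 𝓞 K) ^ classNumber k * T.τ.σ (y ^ classNumber k) = y ^ classNumber k := by
        rw [map_pow, ← mul_pow, ← hyu]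
      rw [← hu', map_mul, map_mul, map_pow, T.apply_α, T.τ.apply_algebraMap, neg_pow] at h1
      have h2 : (u : 𝓞 K) ^ classNumber k * (-1) ^ b * F f' ^ 2 = u' ^ 2 := by
        apply mul_right_cancel₀ hne
        linear_combination (u' : 𝓞 K) * h1 - (u : 𝓞 K) ^ classNumber k * (-1) ^ b *
          (T.α ^ b * algebraMap (𝓞 k) (𝓞 K) c) * hf'
      have h3 : u ^ classNumber k * (-1) ^ b * F f' ^ 2 = u' ^ 2 := Units.ext (by
        simpa using h2)
      refine ⟨u' * (F f')⁻¹ * (u ^ j)⁻¹, ?_⟩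
      have h4 : u ^ classNumber k = u * (u ^ j) ^ 2 := by
        rw [hj, pow_succ', mul_comm 2 j, pow_mul]
      rw [h4] at h3
      rcases Nat.even_or_odd b with hb | hb
      · left
        rw [hb.neg_one_pow, mul_one] at h3
        rw [mul_pow, mul_pow, ← h3, inv_pow, inv_pow]
        group
      · right
        rw [hb.neg_one_pow, mul_neg, mul_one, neg_mul] at h3
        rw [mul_pow, mul_pow, ← h3, inv_pow, inv_pow, neg_mul, neg_mul, neg_neg]
        group
    · exfalso
      obtain ⟨z, hz, -⟩ := Ideal.exists_eq_span_of_mul_span_eq_span (by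
        intro h0
        rw [h0, Ideal.span_singleton_eq_bot.mpr rfl, Ideal.mul_bot,
          Ideal.span_singleton_eq_bot] at h
        exact hyh h) h.symm
      exact hQ z hz
  obtain ⟨t, ht⟩ := hu2
  obtain ⟨g, hg⟩ := Units.eq_sq_mul_of_rank_eq_one T.Q.ι
    (Units.rank_eq_one_of_finrank_eq_two T.Q.ι T.Q.finrank_eq) E.ne_sq f
  obtain ⟨h1, h2, h3, h4⟩ := hv (t * F g)
  have hFneg : ∀ x, F (-x) = -F x := fun x => Units.ext (by simp [hF])
  rw [huv] at h1 h2 h3 h4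
  rcases ht with rfl | rfl <;> rcases hg with rfl | rfl | rfl | rfl <;>
    simp only [hFneg, map_mul, map_pow, mul_pow, neg_mul, mul_neg, neg_neg, ne_eq,
      not_true_eq_false]
      at h1 h2 h3 h4
  · exact h3 (by rw [mul_left_comm])
  · exact h4 (by rw [mul_left_comm])
  · exact h4 (by rw [mul_left_comm])
  · exact h3 (by rw [mul_left_comm])

end QuarticTower

namespace QuarticTower

variable {p : ℕ} {k K : Type} [Field k] [NumberField k] [Field K] [NumberField K]
    [Algebra k K] {T : QuarticTower p k K}

theorem quarticChar_eq_one_of_eq_span [Fact p.Prime] (T : QuarticTower p k K) (hp8 : p % 8 = 1)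
    {b : Ideal (𝓞 K)} {z : 𝓞 K} (hpb : ¬ p ∣ Ideal.absNorm b) (hz : b = Ideal.span {z}) :
    quarticChar p (Ideal.absNorm b) = 1 := by
  subst hz
  apply T.quarticChar_absNorm_span_eq_one hp8
  rintro ⟨c, rfl⟩
  apply hpb
  rw [← Ideal.span_singleton_mul_span_singleton, map_mul, T.absNorm_span_α]
  exact dvd_mul_right _ _

theorem quarticChar_two_eq_neg_one [Fact p.Prime] (hp16 : p % 16 = 9) (R : T.RamifiedTwo)
    (h2 : quarticChar p 2 ≠ 1) : quarticChar p 2 = -1 := by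
  have h := T.quarticChar_sq' (by omega) (I := R.ideal) (by
    rw [R.absNorm_eq]
    intro h
    have := Nat.le_of_dvd two_pos h
    omega)
  rw [R.absNorm_eq] at h
  exact (mul_self_eq_one_iff.mp (by rw [← pow_two]; exact h)).resolve_left h2

/-- If there is a unit of norm `η □`, then `2` is not a quartic residue modulo `p`. -/
theorem quarticChar_two_ne_one [Fact p.Prime] (hp16 : p % 16 = 9) (E : SpecialUnit T.Q)
    {v : (𝓞 K)ˣ} {f : (𝓞 k)ˣ}
    (hv : (v : 𝓞 K) * T.τ.σ v = algebraMap _ _ (E.η * f ^ 2 : 𝓞 k)) : quarticChar p 2 ≠ 1 := by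
  intro h2
  refine T.quarticChar_ne_one_of_norm_eq hp16 E h2 (b := ⊤) (x := v) ?_ ?_ hv ?_
  · rw [Ideal.span_singleton_eq_top.mpr v.isUnit, ← Ideal.one_eq_top, one_pow]
  · rw [Ideal.absNorm_top]
    exact (Fact.out : p.Prime).not_dvd_one
  · rw [Ideal.absNorm_top, map_one]

theorem not_dvd_pow_mul_pow [Fact p.Prime] (hp16 : p % 16 = 9) (R : T.RamifiedTwo)
    {b : Ideal (𝓞 K)} (hpb : ¬ p ∣ Ideal.absNorm b) (m n : ℕ) :
    ¬ p ∣ Ideal.absNorm (b ^ m * R.ideal ^ n) := by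
  have hp : p.Prime := Fact.out
  rw [map_mul, map_pow, map_pow, R.absNorm_eq, hp.dvd_mul, not_or]
  constructor
  · exact fun h => hpb (hp.dvd_of_dvd_pow h)
  · intro h
    have := Nat.le_of_dvd two_pos (hp.dvd_of_dvd_pow h)
    omega

theorem exists_pow_eq_span_of_norm_eq_sq [Fact p.Prime] (hp16 : p % 16 = 9) (R : T.RamifiedTwo)
    (E : SpecialUnit T.Q) {b : Ideal (𝓞 K)} {x : 𝓞 K} (hb : b ^ 2 = Ideal.span {x})
    (hpb : ¬ p ∣ Ideal.absNorm b) (hρ : quarticChar p (Ideal.absNorm b) = 1) {w : 𝓞 k}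
    (hx : x * T.τ.σ x = algebraMap _ _ (w ^ 2)) : ∃ z, b ^ classNumber k = Ideal.span {z} := by
  have hp8 : p % 8 = 1 := by omega
  have hx0 : x ≠ 0 := by
    rintro rfl
    exact T.not_dvd_of_sq_eq_span hb hpb (dvd_zero _)
  obtain ⟨y, hy, d, hd, hyd⟩ := T.τ.exists_sq_mul_span_eq_map two_ne_zero hx0 hx hb
  obtain ⟨n, c, hnc⟩ := R.pow_classNumber (by simpa using hd) hyd
  obtain ⟨z, hz⟩ : ∃ z, z = T.α ^ n * algebraMap (𝓞 k) (𝓞 K) c := ⟨_, rfl⟩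
  have hyh : y ^ classNumber k ≠ 0 := pow_ne_zero _ hy
  rw [← hz, mul_pow, Ideal.span_singleton_pow] at hnc
  rcases hnc with h | h
  · obtain ⟨c, hc, -⟩ := Ideal.exists_eq_span_of_mul_span_eq_span hyh h
    exact ⟨c, hc⟩
  rcases R.isPrincipal_or_exists_unit E with ⟨r, hr⟩ | ⟨v, f, hv⟩
  · rw [hr, Ideal.span_singleton_mul_span_singleton] at h
    obtain ⟨c, hc, -⟩ := Ideal.exists_eq_span_of_mul_span_eq_span hyh h
    exact ⟨c, hc⟩
  exfalso
  have h2 := quarticChar_two_eq_neg_one hp16 R (quarticChar_two_ne_one hp16 E hv)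
  obtain ⟨q, hq⟩ := R.exists_sq_eq
  obtain ⟨r, hr⟩ := exists_pow_classNumber_eq_span q
  have h1 : b ^ classNumber k * R.ideal ^ classNumber k * Ideal.span {y ^ classNumber k} =
      Ideal.span {algebraMap (𝓞 k) (𝓞 K) r * z} := by
    have hr' : (R.ideal ^ 2) ^ classNumber k = Ideal.span {algebraMap (𝓞 k) (𝓞 K) r} := by
      rw [hq, ← Ideal.map_pow, hr, Ideal.map_span, Set.image_singleton]
    rw [← Ideal.span_singleton_mul_span_singleton, ← hr', mul_right_comm, h, pow_right_comm,
      pow_two, mul_right_comm]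
  obtain ⟨c, hc, -⟩ := Ideal.exists_eq_span_of_mul_span_eq_span hyh h1
  have h3 := T.quarticChar_eq_one_of_eq_span hp8 (not_dvd_pow_mul_pow hp16 R hpb _ _) hc
  rw [map_mul, map_pow, map_pow, map_mul, map_pow, map_pow, hρ, R.absNorm_eq, h2, one_pow, one_mul,
    T.Q.odd_classNumber.neg_one_pow] at h3
  exact quarticChar_two_ne_one hp16 E hv (by rw [h2, h3])

/-- An ideal with principal square and trivial quartic symbol is principal. -/
theorem exists_eq_span_of_sq [Fact p.Prime] (hp16 : p % 16 = 9) (T : QuarticTower p k K)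
    {b : Ideal (𝓞 K)} {x : 𝓞 K} (hb : b ^ 2 = Ideal.span {x})
    (hpb : ¬ p ∣ Ideal.absNorm b) (hρ : quarticChar p (Ideal.absNorm b) = 1) :
    ∃ z, b = Ideal.span {z} := by
  have hp8 : p % 8 = 1 := by omega
  obtain ⟨R⟩ := RamifiedTwo.nonempty hp16 T
  obtain ⟨E⟩ := SpecialUnit.nonempty hp8 T.Q
  have hx0 : x ≠ 0 := by
    rintro rfl
    exact T.not_dvd_of_sq_eq_span hb hpb (dvd_zero _)
  have hodd := T.Q.odd_classNumber
  obtain ⟨h, hh⟩ : ∃ h, h = classNumber k := ⟨_, rfl⟩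
  have hbh : (b ^ h) ^ 2 = Ideal.span {x ^ h} := by
    rw [pow_right_comm, hb, Ideal.span_singleton_pow]
  have hpbh : ¬ p ∣ Ideal.absNorm (b ^ h) := by
    rw [map_pow]
    exact fun hd => hpb ((Fact.out : p.Prime).dvd_of_dvd_pow hd)
  have hρh : quarticChar p (Ideal.absNorm (b ^ h)) = 1 := by rw [map_pow, map_pow, hρ, one_pow]
  suffices ∃ z, (b ^ h) ^ h = Ideal.span {z} by
    obtain ⟨z, hz⟩ := this
    rw [← pow_mul] at hz
    rw [← hh] at hodd
    obtain ⟨j, hj⟩ := hodd.mul hodd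
    rw [hj, pow_succ', pow_mul, hb, Ideal.span_singleton_pow] at hz
    obtain ⟨c, hc, -⟩ := Ideal.exists_eq_span_of_mul_span_eq_span (pow_ne_zero j hx0) hz
    exact ⟨c, hc⟩
  obtain ⟨w, hw⟩ := exists_pow_classNumber_eq_span (Ideal.relNorm (𝓞 k) b)
  have hN : Ideal.span {Algebra.intNorm (𝓞 k) (𝓞 K) (x ^ h)} = Ideal.span {w ^ 2} := by
    rw [← Ideal.relNorm_singleton, ← hbh, map_pow, map_pow, hh, hw, Ideal.span_singleton_pow]
  obtain ⟨e, he⟩ := Ideal.span_singleton_eq_span_singleton.mp hN.symm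
  have hnorm : algebraMap (𝓞 k) (𝓞 K) (w ^ 2 * e) = x ^ h * T.τ.σ (x ^ h) := by
    rw [he, T.norm_eq]
  have hpos := T.ι_pos_of_norm (pow_ne_zero h hx0) hnorm
  have hepos : 0 < T.Q.ι (e : 𝓞 k) := by
    have hpos' : 0 < (T.Q.ι.comp (algebraMap (𝓞 k) k)) (w ^ 2 * e) := hpos
    rw [map_mul, map_pow] at hpos'
    exact pos_of_mul_pos_right hpos' (sq_nonneg _)
  obtain ⟨g, hg | hg⟩ := E.eq_sq_or_eq_mul_sq hepos
  · rw [hh]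
    rw [hh] at hbh hpbh hρh hnorm
    refine exists_pow_eq_span_of_norm_eq_sq hp16 R E hbh hpbh hρh (w := w * g) ?_
    rw [← hnorm, hg, Units.val_pow_eq_pow_val]
    rw [mul_pow]
  · have hx' : x ^ h * T.τ.σ (x ^ h) = algebraMap _ _ (E.η * (w * g) ^ 2 : 𝓞 k) := by
      rw [← hnorm, hg, Units.val_mul, Units.val_pow_eq_pow_val]
      congr 1
      ring
    have h2 : quarticChar p 2 ≠ 1 := fun h2 =>
      T.quarticChar_ne_one_of_norm_eq hp16 E h2 hbh hpbh hx' hρh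
    rcases R.isPrincipal_or_exists_unit E with ⟨r, hr⟩ | ⟨v, f, hv⟩
    · exfalso
      have h3 := quarticChar_two_eq_neg_one hp16 R h2
      have h4 := T.quarticChar_eq_one_of_eq_span hp8 (z := r) (b := R.ideal ^ classNumber k) (by
        simpa using not_dvd_pow_mul_pow hp16 R hpb 0 (classNumber k)) hr
      rw [map_pow, map_pow, R.absNorm_eq, h3, hodd.neg_one_pow] at h4
      exact h2 (by rw [h3, h4])
    · rw [hh]
      rw [hh] at hbh hpbh hρh hx'
      refine exists_pow_eq_span_of_norm_eq_sq hp16 R E (x := x ^ classNumber k * v)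
        (w := E.η * (w * g) * f) ?_ hpbh hρh ?_
      · rw [hbh, Ideal.span_singleton_mul_right_unit v.isUnit]
      · rw [map_mul T.τ.σ, mul_mul_mul_comm, hx', hv, ← map_mul]
        congr 1
        ring

end QuarticTower

/-- An auxiliary prime modulo which `p` is a fourth power, but which is a square and not a fourth
power modulo `p`. -/
theorem ZMod.exists_prime_and_dvd_pow_four_sub {p : ℕ} [Fact p.Prime] (hp8 : p % 8 = 1) :
    ∃ l : ℕ, ∃ c : ℤ, l.Prime ∧ (l : ZMod p) ^ ((p - 1) / 4) = -1 ∧ (l : ℤ) ∣ c ^ 4 - p ∧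
      ¬ (l : ℤ) ^ 2 ∣ c ^ 4 - p := by
  have hp : p.Prime := Fact.out
  have hp2 : p ≠ 2 := by omega
  obtain ⟨g, hg⟩ := FiniteField.exists_nonsquare (F := ZMod p) (by rwa [ZMod.ringChar_zmod_n])
  have hg0 : g ≠ 0 := by
    rintro rfl
    exact hg (IsSquare.zero)
  have hg1 : g ^ (p / 2) = -1 :=
    (ZMod.pow_div_two_eq_neg_one_or_one p hg0).resolve_left
      (fun h => hg ((ZMod.euler_criterion p hg0).mpr h))
  have hcop : Nat.Coprime 4 p := by
    rw [show 4 = 2 ^ 2 by rfl]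
    exact Nat.Coprime.pow_left _ ((Nat.coprime_primes Nat.prime_two hp).mpr hp2.symm)
  obtain ⟨a, ha4, hap⟩ := Nat.chineseRemainder hcop 3 (g ^ 2).val
  have hap' : (a : ZMod p) = g ^ 2 := by
    rw [(ZMod.natCast_eq_natCast_iff _ _ _).mpr hap, ZMod.natCast_zmod_val]
  have hac : a.Coprime (4 * p) := by
    apply Nat.Coprime.mul_right
    · rw [Nat.coprime_iff_gcd_eq_one, ha4.gcd_eq]
      rfl
    · rw [← ZMod.isUnit_iff_coprime, hap']
      exact (IsUnit.mk0 g hg0).pow 2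
  obtain ⟨l, hlp, hl, hla⟩ := Nat.forall_exists_prime_gt_and_modEq p (by have := hp.pos; omega) hac
  have : Fact l.Prime := ⟨hl⟩
  have hl4 : l % 4 = 3 := (hla.of_mul_right p).trans ha4
  have hlg : (l : ZMod p) = g ^ 2 := by
    rw [(ZMod.natCast_eq_natCast_iff _ _ _).mpr (hla.of_mul_left 4), hap']
  have hp0 : (p : ZMod l) ≠ 0 := by
    rw [Ne, ZMod.natCast_eq_zero_iff]
    intro h
    have := Nat.le_of_dvd hp.pos h
    omega
  obtain ⟨d, hd⟩ : IsSquare (p : ZMod l) :=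
    (ZMod.exists_sq_eq_prime_iff_of_mod_four_eq_one (by omega) (by omega)).mp
      ⟨g, by rw [hlg, pow_two]⟩
  obtain ⟨c, hc⟩ : ∃ c : ZMod l, c ^ 4 = p := by
    by_cases h : IsSquare d
    · obtain ⟨c, rfl⟩ := h
      exact ⟨c, by rw [hd]; ring⟩
    · have h' : IsSquare (-d) := by
        have hd0 : d ≠ 0 := by
          rintro rfl
          exact h IsSquare.zero
        rw [ZMod.euler_criterion l (neg_ne_zero.mpr hd0), Odd.neg_pow ⟨l / 4, by omega⟩,
          (ZMod.pow_div_two_eq_neg_one_or_one l hd0).resolve_left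
            (fun h' => h ((ZMod.euler_criterion l hd0).mpr h')), neg_neg]
      obtain ⟨c, hc⟩ := h'
      exact ⟨c, by rw [hd, ← neg_mul_neg, hc]; ring⟩
  obtain ⟨c, rfl⟩ := ZMod.intCast_surjective c
  have hc0 : ¬ (l : ℤ) ∣ 4 * c ^ 3 := by
    rw [← ZMod.intCast_zmod_eq_zero_iff_dvd]
    push_cast
    intro h
    rcases mul_eq_zero.mp h with h | h
    · have h4 : ((4 : ℕ) : ZMod l) = 0 := by exact_mod_cast h
      rw [ZMod.natCast_eq_zero_iff, show 4 = 2 ^ 2 by rfl] at h4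
      have := Nat.le_of_dvd two_pos (hl.dvd_of_dvd_pow h4)
      omega
    · rw [pow_eq_zero_iff (by norm_num)] at h
      rw [h] at hc
      exact hp0 (by rw [← hc]; simp)
  have hdvd : (l : ℤ) ∣ c ^ 4 - p := by
    rw [← ZMod.intCast_zmod_eq_zero_iff_dvd]
    push_cast
    rw [hc, sub_self]
  have hpow : (l : ZMod p) ^ ((p - 1) / 4) = -1 := by
    rw [hlg, ← pow_mul, ← hg1]
    congr 1
    omega
  by_cases h2 : (l : ℤ) ^ 2 ∣ c ^ 4 - p
  · refine ⟨l, c + l, hl, hpow, ?_, ?_⟩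
    · have h : (c + l) ^ 4 - p =
          (c ^ 4 - p) + (l : ℤ) * (4 * c ^ 3 + 6 * c ^ 2 * l + 4 * c * l ^ 2 + l ^ 3) := by ring
      rw [h]
      exact dvd_add hdvd (dvd_mul_right _ _)
    · have h : (c + l) ^ 4 - p =
          ((c ^ 4 - p) + (l : ℤ) ^ 2 * (6 * c ^ 2 + 4 * c * l + l ^ 2)) + l * (4 * c ^ 3) := by ring
      rw [h, dvd_add_right (dvd_add h2 (dvd_mul_right _ _)), pow_two]
      rw [mul_dvd_mul_iff_left (by exact_mod_cast hl.ne_zero)]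
      exact hc0
  · exact ⟨l, c, hl, hpow, hdvd, h2⟩

namespace QuarticTower

variable {p : ℕ} {k K : Type} [Field k] [NumberField k] [Field K] [NumberField K]
    [Algebra k K] {T : QuarticTower p k K}

theorem absNorm_span_natCast (T : QuarticTower p k K) (n : ℕ) :
    Ideal.absNorm (Ideal.span {(n : 𝓞 K)}) = n ^ 4 := by
  rw [Ideal.absNorm_span_natCast, RingOfIntegers.rank, T.finrank_eq]

theorem absNorm_span_intCast (T : QuarticTower p k K) (n : ℤ) :
    Ideal.absNorm (Ideal.span {(n : 𝓞 K)}) = n.natAbs ^ 4 := by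
  rw [← T.absNorm_span_natCast]
  rcases Int.natAbs_eq n with h | h
  · conv_lhs => rw [h, Int.cast_natCast]
  · conv_lhs => rw [h, Int.cast_neg, Int.cast_natCast, Ideal.span_singleton_neg]

theorem absNorm_span_α_sub_intCast (T : QuarticTower p k K) (c : ℤ) :
    Ideal.absNorm (Ideal.span {T.α - c}) = (c ^ 4 - p).natAbs := by
  have h : Algebra.intNorm (𝓞 k) (𝓞 K) (T.α - c) = c ^ 2 - T.Q.s := by
    apply FaithfulSMul.algebraMap_injective (𝓞 k) (𝓞 K)
    rw [T.norm_eq, map_sub, T.apply_α, map_sub, ← T.α_sq, map_pow, map_intCast, map_intCast]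
    ring
  rw [← Ideal.absNorm_relNorm (𝓞 k) (𝓞 K), Ideal.relNorm_singleton, h,
    Ideal.absNorm_span_singleton]
  congr 1
  apply Int.cast_injective (α := 𝓞 k)
  rw [T.Q.norm_eq, map_sub, map_pow, map_intCast, T.Q.apply_s]
  push_cast
  rw [← T.Q.s_sq]
  ring

theorem exists_quarticChar_absNorm_eq_neg_one [Fact p.Prime] (T : QuarticTower p k K)
    (hp8 : p % 8 = 1) :
    ∃ I : Ideal (𝓞 K), ¬ p ∣ Ideal.absNorm I ∧ quarticChar p (Ideal.absNorm I) = -1 := by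
  obtain ⟨l, c, hl, hρ, hlc, hlc2⟩ := ZMod.exists_prime_and_dvd_pow_four_sub hp8
  have hlp : ¬ p ∣ l := by
    rw [← ZMod.natCast_eq_zero_iff]
    intro h
    rw [h, zero_pow (by have := (Fact.out : p.Prime).two_le; omega)] at hρ
    simp at hρ
  obtain ⟨n, hn⟩ : ∃ n, n = (c ^ 4 - p).natAbs := ⟨_, rfl⟩
  have hln : l ∣ n := by rwa [hn, ← Int.natCast_dvd]
  have hln2 : ¬ l ^ 2 ∣ n := by
    rwa [hn, ← Int.natCast_dvd, Nat.cast_pow]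
  refine ⟨Ideal.span {(l : 𝓞 K), T.α - c}, ?_⟩
  have h1 : Ideal.absNorm (Ideal.span {(l : 𝓞 K), T.α - c}) ∣ l ^ 4 := by
    rw [← T.absNorm_span_natCast]
    exact Ideal.absNorm_dvd_absNorm_of_le (Ideal.span_mono (by simp))
  have h2 : Ideal.absNorm (Ideal.span {(l : 𝓞 K), T.α - c}) ∣ n := by
    rw [hn, ← T.absNorm_span_α_sub_intCast]
    exact Ideal.absNorm_dvd_absNorm_of_le (Ideal.span_mono (by simp))
  obtain ⟨i, -, hi⟩ := (Nat.dvd_prime_pow hl).mp h1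
  have hi1 : i = 1 := by
    have hi2 : i < 2 := by
      by_contra! h
      exact hln2 ((pow_dvd_pow l h).trans (hi ▸ h2))
    have hi0 : i ≠ 0 := by
      rintro rfl
      rw [pow_zero, Ideal.absNorm_eq_one_iff, Ideal.eq_top_iff_one, Ideal.mem_span_pair] at hi
      obtain ⟨x, y, hxy⟩ := hi
      obtain ⟨β, hβ⟩ : ∃ β, β = (T.α + c) * (T.α ^ 2 + c ^ 2) := ⟨_, rfl⟩
      have hβ1 : (T.α - c) * β = -((c ^ 4 - p : ℤ) : 𝓞 K) := by
        push_cast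
        have h4 : T.α ^ 4 = p := by
          rw [show T.α ^ 4 = (T.α ^ 2) ^ 2 by ring, T.α_sq, ← map_pow, T.Q.s_sq, map_natCast]
        rw [hβ, ← h4]
        ring
      have hβ2 : (l : 𝓞 K) ∣ β := by
        obtain ⟨m, hm⟩ := hlc
        refine ⟨x * β - m * y, ?_⟩
        rw [hm] at hβ1
        push_cast at hβ1
        linear_combination (-β) * hxy + y * hβ1
      have h3 := Ideal.absNorm_dvd_absNorm_of_le (Ideal.span_singleton_le_span_singleton.mpr hβ2)
      rw [T.absNorm_span_natCast] at h3
      have h4 : n * Ideal.absNorm (Ideal.span {β}) = n ^ 4 := by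
        rw [← T.absNorm_span_natCast n, hn, ← T.absNorm_span_α_sub_intCast, ← map_mul,
          Ideal.span_singleton_mul_span_singleton, hβ1, Ideal.span_singleton_neg,
          T.absNorm_span_α_sub_intCast]
        rw [T.absNorm_span_intCast, T.absNorm_span_natCast]
      obtain ⟨m, rfl⟩ := hln
      have hlm : ¬ l ∣ m := fun h => hln2 (by rw [pow_two]; exact mul_dvd_mul_left l h)
      have h5 : l ^ 4 * (l * m) ∣ (l * m) ^ 4 := by
        rw [← h4, mul_comm]
        exact mul_dvd_mul_left _ h3
      rw [show l ^ 4 * (l * m) = l ^ 4 * m * l by ring,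
        show (l * m) ^ 4 = l ^ 4 * m * m ^ 3 by ring] at h5
      have hm0 : m ≠ 0 := fun h => hlm (h ▸ dvd_zero _)
      exact hlm (hl.dvd_of_dvd_pow (Nat.dvd_of_mul_dvd_mul_left
        (Nat.pos_of_ne_zero (mul_ne_zero (pow_ne_zero _ hl.ne_zero) hm0)) h5))
    omega
  rw [hi, hi1, pow_one]
  exact ⟨hlp, hρ⟩

theorem even_classNumber [Fact p.Prime] (T : QuarticTower p k K) (hp8 : p % 8 = 1) :
    Even (classNumber K) := by
  by_contra hodd
  rw [Nat.not_even_iff_odd] at hodd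
  obtain ⟨I, hpI, hρ⟩ := T.exists_quarticChar_absNorm_eq_neg_one hp8
  obtain ⟨c, hc⟩ := exists_pow_classNumber_eq_span I
  have h := T.quarticChar_eq_one_of_eq_span hp8 (b := I ^ classNumber K) (by
    rw [map_pow]
    exact fun h => hpI ((Fact.out : p.Prime).dvd_of_dvd_pow h)) hc
  rw [map_pow, map_pow, hρ, hodd.neg_one_pow] at h
  have : Fact (2 < p) := ⟨by have := (Fact.out : p.Prime).two_le; omega⟩
  exact ZMod.neg_one_ne_one h

theorem not_dvd_absNorm [Fact p.Prime] (T : QuarticTower p k K) (hp8 : p % 8 = 1) {I : Ideal (𝓞 K)}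
    (hI : ¬ Ideal.span {T.α} ∣ I) : ¬ p ∣ Ideal.absNorm I := by
  have hmax : (Ideal.span {T.α}).IsMaximal := T.isPrime_span_α.isMaximal (by
    rw [Ne, Ideal.span_singleton_eq_bot]
    exact T.α_ne_zero)
  rw [Ideal.dvd_iff_le] at hI
  obtain ⟨x, hx, hxα⟩ := Set.not_subset.mp hI
  rw [SetLike.mem_coe, Ideal.mem_span_singleton] at hxα
  have h := T.quarticChar_absNorm_span_eq_one hp8 hxα
  intro hp
  have h1 : p ∣ Ideal.absNorm (Ideal.span {x}) := hp.trans
    (Ideal.absNorm_dvd_absNorm_of_le ((Ideal.span_singleton_le_iff_mem _).mpr hx))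
  rw [quarticChar_apply, (ZMod.natCast_eq_zero_iff _ _).mpr h1,
    zero_pow (by have := (Fact.out : p.Prime).two_le; omega)] at h
  exact zero_ne_one h

theorem exists_mk0_eq [Fact p.Prime] (T : QuarticTower p k K) (hp8 : p % 8 = 1)
    (g : ClassGroup (𝓞 K)) : ∃ I : nonZeroDivisors (Ideal (𝓞 K)),
      ClassGroup.mk0 I = g ∧ ¬ p ∣ Ideal.absNorm (I : Ideal (𝓞 K)) := by
  obtain ⟨I, rfl⟩ := ClassGroup.mk0_surjective g
  have hα0 : Ideal.span {T.α} ≠ 0 := by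
    rw [Ideal.zero_eq_bot, Ne, Ideal.span_singleton_eq_bot]
    exact T.α_ne_zero
  have hprime : Prime (Ideal.span {T.α}) := Ideal.prime_of_isPrime hα0 T.isPrime_span_α
  obtain ⟨n, J, hJ, hIJ⟩ := WfDvdMonoid.max_power_factor (nonZeroDivisors.ne_zero I.2)
    hprime.irreducible
  have hJ0 : J ≠ 0 := by
    rintro rfl
    exact hJ (dvd_zero _)
  refine ⟨⟨J, mem_nonZeroDivisors_of_ne_zero hJ0⟩, ?_, T.not_dvd_absNorm hp8 hJ⟩
  rw [ClassGroup.mk0_eq_mk0_iff]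
  refine ⟨T.α ^ n, 1, pow_ne_zero _ T.α_ne_zero, one_ne_zero, ?_⟩
  rw [hIJ, Ideal.span_singleton_pow]
  simp

end QuarticTower

namespace QuarticTower

open scoped nonZeroDivisors

variable {p : ℕ} {k K : Type} [Field k] [NumberField k] [Field K] [NumberField K]
    [Algebra k K]

theorem mk0_eq_one_of_sq_eq_one [Fact p.Prime] (hp16 : p % 16 = 9) (T : QuarticTower p k K)
    (I : (Ideal (𝓞 K))⁰) (hI : ClassGroup.mk0 I ^ 2 = 1)
    (hpI : ¬ p ∣ Ideal.absNorm (I : Ideal (𝓞 K)))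
    (hρ : quarticChar p (Ideal.absNorm (I : Ideal (𝓞 K))) = 1) : ClassGroup.mk0 I = 1 := by
  rw [← map_pow, ClassGroup.mk0_eq_one_iff] at hI
  obtain ⟨x, hx⟩ := hI
  rw [ClassGroup.mk0_eq_one_iff]
  obtain ⟨z, hz⟩ := T.exists_eq_span_of_sq hp16 (x := x) (by simpa using hx) hpI hρ
  exact ⟨z, hz⟩

theorem sq_eq_one_of_pow_four_eq_one [Fact p.Prime] (hp16 : p % 16 = 9) (T : QuarticTower p k K)
    {g : ClassGroup (𝓞 K)} (hg : g ^ 4 = 1) : g ^ 2 = 1 := by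
  obtain ⟨I, rfl, hpI⟩ := T.exists_mk0_eq (by omega) g
  rw [← map_pow]
  apply T.mk0_eq_one_of_sq_eq_one hp16
  · rw [map_pow, ← pow_mul, hg]
  · rw [SubmonoidClass.coe_pow, map_pow]
    exact fun h => hpI ((Fact.out : p.Prime).dvd_of_dvd_pow h)
  · rw [SubmonoidClass.coe_pow, map_pow, map_pow, T.quarticChar_sq' (by omega) hpI]

theorem mk0_eq_mk0_of_quarticChar_eq [Fact p.Prime] (hp16 : p % 16 = 9) (T : QuarticTower p k K)
    (I J : (Ideal (𝓞 K))⁰) (hI : ClassGroup.mk0 I ^ 2 = 1) (hJ : ClassGroup.mk0 J ^ 2 = 1)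
    (hpI : ¬ p ∣ Ideal.absNorm (I : Ideal (𝓞 K))) (hpJ : ¬ p ∣ Ideal.absNorm (J : Ideal (𝓞 K)))
    (hρ : quarticChar p (Ideal.absNorm (I : Ideal (𝓞 K))) =
      quarticChar p (Ideal.absNorm (J : Ideal (𝓞 K)))) : ClassGroup.mk0 I = ClassGroup.mk0 J := by
  have h : ClassGroup.mk0 (I * J) = 1 := by
    apply T.mk0_eq_one_of_sq_eq_one hp16
    · rw [map_mul, mul_pow, hI, hJ, one_mul]
    · rw [Submonoid.coe_mul, map_mul, (Fact.out : p.Prime).dvd_mul]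
      tauto
    · rw [Submonoid.coe_mul, map_mul, map_mul, hρ, ← pow_two, T.quarticChar_sq' (by omega) hpJ]
  rw [map_mul] at h
  rw [eq_inv_of_mul_eq_one_left h, inv_eq_of_mul_eq_one_right (by rw [← pow_two, hJ])]

theorem not_four_dvd_classNumber [Fact p.Prime] (hp16 : p % 16 = 9) (T : QuarticTower p k K) :
    ¬ 4 ∣ classNumber K := by
  intro h4
  have : Fact (Nat.Prime 2) := ⟨Nat.prime_two⟩
  obtain ⟨H, hH⟩ := Sylow.exists_subgroup_card_pow_prime (G := ClassGroup (𝓞 K)) 2 (n := 2)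
    (by rw [Nat.card_eq_fintype_card]; exact h4)
  have hsq : ∀ g : H, (g : ClassGroup (𝓞 K)) ^ 2 = 1 := fun g =>
    T.sq_eq_one_of_pow_four_eq_one hp16 (by
      have := pow_card_eq_one' (x := g)
      rw [hH] at this
      exact_mod_cast this)
  have := Fintype.ofFinite H
  rw [Nat.card_eq_fintype_card] at hH
  obtain ⟨a, b, c, hab, hac, hbc⟩ := Fintype.two_lt_card_iff.mp (by omega : 2 < Fintype.card H)
  obtain ⟨I, hI, hpI⟩ := T.exists_mk0_eq (by omega) a
  obtain ⟨J, hJ, hpJ⟩ := T.exists_mk0_eq (by omega) b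
  obtain ⟨L, hL, hpL⟩ := T.exists_mk0_eq (by omega) c
  have key : ∀ {x y : H} {I J : (Ideal (𝓞 K))⁰}, x ≠ y → ClassGroup.mk0 I = (x : ClassGroup (𝓞 K)) →
      ClassGroup.mk0 J = (y : ClassGroup (𝓞 K)) → ¬ p ∣ Ideal.absNorm (I : Ideal (𝓞 K)) →
      ¬ p ∣ Ideal.absNorm (J : Ideal (𝓞 K)) →
      quarticChar p (Ideal.absNorm (I : Ideal (𝓞 K))) ≠
        quarticChar p (Ideal.absNorm (J : Ideal (𝓞 K))) := by
    intro x y I J hxy hx hy hpI hpJ hρ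
    apply hxy
    apply Subtype.ext
    rw [← hx, ← hy]
    exact T.mk0_eq_mk0_of_quarticChar_eq hp16 I J (by rw [hx, hsq]) (by rw [hy, hsq]) hpI hpJ hρ
  have h1 := key hab hI hJ hpI hpJ
  have h2 := key hac hI hL hpI hpL
  have h3 := key hbc hJ hL hpJ hpL
  have hsign : ∀ {I : Ideal (𝓞 K)}, ¬ p ∣ Ideal.absNorm I →
      quarticChar p (Ideal.absNorm I) = 1 ∨ quarticChar p (Ideal.absNorm I) = -1 := fun hI =>
    mul_self_eq_one_iff.mp (by rw [← pow_two]; exact T.quarticChar_sq' (by omega) hI)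
  rcases hsign hpI with hI' | hI' <;> rcases hsign hpJ with hJ' | hJ' <;>
    rcases hsign hpL with hL' | hL' <;> simp_all

theorem classNumber_mod_four [Fact p.Prime] (hp16 : p % 16 = 9) (T : QuarticTower p k K) :
    classNumber K % 4 = 2 := by
  obtain ⟨n, hn⟩ := T.even_classNumber (by omega)
  have := T.not_four_dvd_classNumber hp16
  omega

end QuarticTower

/-- The conjugation of a quadratic extension in characteristic zero. -/
theorem Algebra.exists_conj_of_finrank_eq_two {F E : Type*} [Field F] [Field E] [Algebra F E]
    [CharZero F] (h : Module.finrank F E = 2) : ∃ σ : E ≃ₐ[F] E, (∀ x, σ (σ x) = x) ∧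
      (∀ x, σ x = x → ∃ a, algebraMap F E a = x) ∧
      ∀ x, algebraMap F E (Algebra.norm F x) = x * σ x := by
  have hquad : Algebra.IsQuadraticExtension F E := ⟨h⟩
  have hfin : FiniteDimensional F E := Module.finite_of_finrank_pos (by omega)
  have hcard : Nat.card (E ≃ₐ[F] E) = 2 := by rw [IsGalois.card_aut_eq_finrank, h]
  obtain ⟨σ, hσ, huniq⟩ := (Nat.card_eq_two_iff' (1 : E ≃ₐ[F] E)).mp hcard
  have hall : ∀ f : E ≃ₐ[F] E, f = 1 ∨ f = σ := fun f => or_iff_not_imp_left.mpr (huniq f)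
  refine ⟨σ, fun x => ?_, fun x hx => ?_, fun x => ?_⟩
  · rcases hall (σ * σ) with h | h
    · exact DFunLike.congr_fun h x
    · exact absurd (mul_eq_left.mp h) hσ
  · rw [← Set.mem_range, ← IntermediateField.mem_bot, IsGalois.mem_bot_iff_fixed]
    intro f
    rcases hall f with rfl | rfl
    · rfl
    · exact hx
  · classical
    have huniv : (Finset.univ : Finset (E ≃ₐ[F] E)) = {1, σ} := by
      ext f
      simpa using hall f
    rw [Algebra.norm_eq_prod_automorphisms, huniv, Finset.prod_pair hσ.symm]
    rfl

theorem neg_of_conj_of_notMem_range {F E : Type*} [Field F] [Field E] [Algebra F E]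
    {σ : E ≃ₐ[F] E} (hσ : ∀ x, σ x = x → ∃ a, algebraMap F E a = x) {x : E} {a : F}
    (hx : x ^ 2 = algebraMap F E a) (hx' : ∀ b, algebraMap F E b ≠ x) : σ x = -x := by
  have h : σ x ^ 2 = x ^ 2 := by rw [← map_pow, hx, σ.commutes]
  rcases sq_eq_sq_iff_eq_or_eq_neg.mp h with h | h
  · obtain ⟨b, hb⟩ := hσ x h
    exact absurd hb (hx' b)
  · exact h

/-- The restriction of a conjugation to the ring of integers, over `ℤ`. -/
noncomputable def FixedInvolution.ofConjInt {E : Type*} [Field E] [NumberField E] (σ : E ≃ₐ[ℚ] E)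
    (hσ : ∀ x, σ (σ x) = x) (hfix : ∀ x, σ x = x → ∃ a, algebraMap ℚ E a = x) :
    FixedInvolution ℤ (𝓞 E) where
  σ := RingOfIntegers.mapRingEquiv σ.toRingEquiv
  apply_apply x := RingOfIntegers.ext (hσ x)
  apply_algebraMap a := by simp
  exists_of_fixed x hx := by
    obtain ⟨a, ha⟩ := hfix x (congrArg (fun y : 𝓞 E => (y : E)) hx)
    have hInt : IsIntegral ℤ a := by
      rw [← isIntegral_algebraMap_iff (algebraMap ℚ E).injective, ha]
      exact x.isIntegral_coe
    obtain ⟨n, rfl⟩ := IsIntegrallyClosed.isIntegral_iff.mp hInt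
    refine ⟨n, RingOfIntegers.ext ?_⟩
    rw [← ha]
    simp

/-- The restriction of a conjugation to the rings of integers. -/
noncomputable def FixedInvolution.ofConj {F E : Type*} [Field F] [NumberField F] [Field E]
    [NumberField E] [Algebra F E] (σ : E ≃ₐ[F] E)
    (hσ : ∀ x, σ (σ x) = x) (hfix : ∀ x, σ x = x → ∃ a, algebraMap F E a = x) :
    FixedInvolution (𝓞 F) (𝓞 E) where
  σ := RingOfIntegers.mapRingEquiv σ.toRingEquiv
  apply_apply x := RingOfIntegers.ext (hσ x)
  apply_algebraMap a := RingOfIntegers.ext (σ.commutes a)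
  exists_of_fixed x hx := by
    obtain ⟨a, ha⟩ := hfix x (congrArg (fun y : 𝓞 E => (y : E)) hx)
    have hInt : IsIntegral ℤ a := by
      rw [← isIntegral_algebraMap_iff (algebraMap F E).injective, ha]
      exact x.isIntegral_coe
    exact ⟨⟨a, hInt⟩, RingOfIntegers.ext ha⟩

open Polynomial in
theorem Polynomial.irreducible_X_pow_sub_C_natCast {p n : ℕ} (hp : p.Prime) (hn : n ≠ 0) :
    Irreducible (X ^ n - C (p : ℚ)) := by
  have hp' : Prime (p : ℤ) := Nat.prime_iff_prime_int.mp hp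
  have hm : (X ^ n - C (p : ℤ)).Monic := monic_X_pow_sub_C _ hn
  have hmap : (X ^ n - C (p : ℤ)).map (Int.castRingHom ℚ) = X ^ n - C (p : ℚ) := by simp
  rw [← hmap, ← IsPrimitive.Int.irreducible_iff_irreducible_map_cast hm.isPrimitive]
  refine irreducible_of_eisenstein_criterion (P := Ideal.span {(p : ℤ)})
    ((Ideal.span_singleton_prime hp'.ne_zero).mpr hp') ?_ ?_ ?_ ?_ hm.isPrimitive
  · rw [hm.leadingCoeff, Ideal.mem_span_singleton]
    exact fun h => hp'.not_isUnit (isUnit_of_dvd_one h)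
  · intro i hi
    rw [degree_X_pow_sub_C (Nat.pos_of_ne_zero hn), Nat.cast_lt] at hi
    rw [coeff_sub, coeff_X_pow, if_neg hi.ne, coeff_C, zero_sub]
    split_ifs
    · exact neg_mem (Ideal.mem_span_singleton_self _)
    · simp
  · rw [degree_X_pow_sub_C (Nat.pos_of_ne_zero hn)]
    exact_mod_cast Nat.pos_of_ne_zero hn
  · rw [coeff_sub, coeff_X_pow, if_neg hn.symm, coeff_C_zero, zero_sub, neg_mem_iff,
      Ideal.span_singleton_pow, Ideal.mem_span_singleton, pow_two]
    exact fun h => hp'.not_isUnit (isUnit_of_dvd_one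
      ((mul_dvd_mul_iff_left hp'.ne_zero).mp (by rwa [mul_one])))

theorem minpoly_eq_X_pow_sub_C_natCast {p n : ℕ} (hp : p.Prime) (hn : n ≠ 0) {K : Type*} [Field K]
    [Algebra ℚ K] {x : K} (hx : x ^ n = p) :
    minpoly ℚ x = Polynomial.X ^ n - Polynomial.C (p : ℚ) :=
  (minpoly.eq_of_irreducible_of_monic (Polynomial.irreducible_X_pow_sub_C_natCast hp hn)
    (by simp [hx]) (Polynomial.monic_X_pow_sub_C _ hn)).symm

theorem isIntegral_half_one_add {k : Type*} [Field k] [CharZero k] {p : ℕ} (hp4 : p % 4 = 1) {x : k}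
    (hx : x ^ 2 = p) : IsIntegral ℤ ((1 + x) / 2) := by
  obtain ⟨m, hm⟩ : ∃ m, p = 4 * m + 1 := ⟨p / 4, by omega⟩
  refine ⟨Polynomial.X ^ 2 - (Polynomial.X + Polynomial.C (m : ℤ)), ?_, ?_⟩
  · apply Polynomial.monic_X_pow_sub
    compute_degree!
  · rw [hm] at hx
    push_cast at hx
    simp
    linear_combination hx / 4

theorem RealQuadratic.exists_of_sq_eq {k : Type} [Field k] [NumberField k] {p : ℕ} (hp : p.Prime)
    (hp4 : p % 4 = 1) (h2 : Module.finrank ℚ k = 2) {x : k} (hx : x ^ 2 = p) (ι : k →+* ℝ)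
    (hι : 0 < ι x) : ∃ Q : RealQuadratic p k, (Q.s : k) = x := by
  obtain ⟨σ, hσ, hfix, hnorm⟩ := Algebra.exists_conj_of_finrank_eq_two h2
  have hσx : σ x = -x := by
    refine neg_of_conj_of_notMem_range hfix (a := (p : ℚ)) (by simpa using hx) fun b hb => ?_
    have h : minpoly ℚ x = _ := minpoly_eq_X_pow_sub_C_natCast hp two_ne_zero hx
    have hdeg := congrArg Polynomial.natDegree h
    rw [← hb, minpoly.eq_X_sub_C, Polynomial.natDegree_X_sub_C,
      Polynomial.natDegree_X_pow_sub_C] at hdeg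
    omega
  have hxint : IsIntegral ℤ x := by
    have : IsIntegral ℤ (x ^ 2) := by
      rw [hx]
      exact_mod_cast isIntegral_algebraMap (R := ℤ) (x := (p : ℤ))
    exact this.of_pow two_pos
  obtain ⟨s, rfl⟩ : ∃ s : 𝓞 k, (s : k) = x := ⟨⟨x, hxint⟩, rfl⟩
  refine ⟨{ s := s
            ω := ⟨(1 + s) / 2, isIntegral_half_one_add hp4 hx⟩
            τ := FixedInvolution.ofConjInt σ hσ hfix
            ι := ι.comp (σ : k →+* k)
            s_sq := RingOfIntegers.ext (by simpa using hx)
            two_mul_ω := RingOfIntegers.ext (mul_div_cancel₀ _ two_ne_zero)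
            apply_s := RingOfIntegers.ext hσx
            norm_eq := fun y => RingOfIntegers.ext ?_
            ι_s := ?_
            finrank_eq := h2 }, rfl⟩
  · refine Eq.trans ?_ (hnorm y)
    rw [← Algebra.coe_norm_int]
    simp
  · change ι (σ s) < 0
    rw [hσx, map_neg]
    linarith

open IntermediateField in
theorem QuarticTower.exists_of_pow_four_eq {p : ℕ} (hp : p.Prime) (hp16 : p % 16 = 9)
    {K : Type} [Field K] [NumberField K] {a : K} (ha : a ^ 4 = p)
    (hgen : Algebra.adjoin ℚ {a} = ⊤) : Nonempty (QuarticTower p ℚ⟮a ^ 2⟯ K) := by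
  have hInt : IsIntegral ℚ a := Algebra.IsIntegral.isIntegral a
  have hpoly := minpoly_eq_X_pow_sub_C_natCast hp four_ne_zero ha
  have hadj : ℚ⟮a⟯ = ⊤ := IntermediateField.adjoin_eq_top_of_algebra ℚ {a} hgen
  have h4 : Module.finrank ℚ K = 4 := by
    rw [← IntermediateField.finrank_top', ← hadj, IntermediateField.adjoin.finrank hInt, hpoly,
      Polynomial.natDegree_X_pow_sub_C]
  have ha2 : (a ^ 2) ^ 2 = p := by rw [← pow_mul, ha]
  have h2 : Module.finrank ℚ ℚ⟮a ^ 2⟯ = 2 := by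
    rw [IntermediateField.adjoin.finrank (hInt.pow 2),
      minpoly_eq_X_pow_sub_C_natCast hp two_ne_zero ha2, Polynomial.natDegree_X_pow_sub_C]
  have hrel : Module.finrank ℚ⟮a ^ 2⟯ K = 2 := by
    have := Module.finrank_mul_finrank ℚ ℚ⟮a ^ 2⟯ K
    rw [h2, h4] at this
    exact Nat.eq_of_mul_eq_mul_left two_pos this
  obtain ⟨ι, hι⟩ : ∃ ι : K →+* ℝ, 0 < ι (a ^ 2) := by
    let pb := PowerBasis.ofAdjoinEqTop' hInt hgen
    have hroot : Polynomial.aeval √(√(p : ℝ)) (minpoly ℚ pb.gen) = 0 := by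
      rw [PowerBasis.ofAdjoinEqTop'_gen, hpoly]
      have h := Real.sq_sqrt (Real.sqrt_nonneg (p : ℝ))
      have h' := Real.sq_sqrt (Nat.cast_nonneg (α := ℝ) p)
      simp only [map_sub, map_pow, Polynomial.aeval_X, map_natCast]
      rw [show √(√(p : ℝ)) ^ 4 = (√(√(p : ℝ)) ^ 2) ^ 2 by ring, h, h', sub_self]
    refine ⟨(pb.lift _ hroot).toRingHom, ?_⟩
    have ha0 : a ≠ 0 := by
      rintro rfl
      rw [zero_pow four_ne_zero] at ha
      exact hp.ne_zero (by exact_mod_cast ha.symm)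
    rw [map_pow]
    exact sq_pos_of_ne_zero ((map_ne_zero _).mpr ha0)
  have hιk : 0 < (ι.comp (algebraMap ℚ⟮a ^ 2⟯ K)) (AdjoinSimple.gen ℚ (a ^ 2)) := hι
  obtain ⟨Q, hQ⟩ := RealQuadratic.exists_of_sq_eq hp (by omega) h2
    (x := AdjoinSimple.gen ℚ (a ^ 2)) (Subtype.ext ha2) _ hιk
  obtain ⟨σ, hσ, hfix, hnorm⟩ := Algebra.exists_conj_of_finrank_eq_two hrel
  have hσa : σ a = -a := by
    refine neg_of_conj_of_notMem_range hfix (a := AdjoinSimple.gen ℚ (a ^ 2)) rfl fun b hb => ?_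
    have hmem : a ∈ ℚ⟮a ^ 2⟯ := by
      have := b.2
      rwa [show (b : K) = a from hb] at this
    have hle : ℚ⟮a⟯ ≤ ℚ⟮a ^ 2⟯ := IntermediateField.adjoin_simple_le_iff.mpr hmem
    rw [hadj, top_le_iff] at hle
    rw [hle, IntermediateField.finrank_top', h4] at h2
    omega
  have haint : IsIntegral ℤ a := by
    have : IsIntegral ℤ (a ^ 4) := by
      rw [ha]
      exact_mod_cast isIntegral_algebraMap (R := ℤ) (x := (p : ℤ))
    exact this.of_pow four_pos
  exact ⟨
    { Q := Q
      α := ⟨a, haint⟩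
      τ := FixedInvolution.ofConj σ hσ hfix
      ι := ι
      α_sq := RingOfIntegers.ext (by
        change a ^ 2 = algebraMap ℚ⟮a ^ 2⟯ K Q.s
        rw [hQ]
        rfl)
      apply_α := RingOfIntegers.ext hσa
      norm_eq := fun y => RingOfIntegers.ext (by
        refine Eq.trans ?_ (hnorm y)
        rw [← Algebra.algebraMap_intNorm (A := 𝓞 ℚ⟮a ^ 2⟯) (B := 𝓞 K)]
        rfl)
      finrank_eq := h4
      relfinrank_eq :=
        (IsFractionRing.finrank_eq (𝓞 ℚ⟮a ^ 2⟯) ℚ⟮a ^ 2⟯ (𝓞 K) K).symm.trans hrel }⟩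

/-- **Theorem 10 (Lemmermeyer).** If `p` is a prime with `p ≡ 9 (mod 16)`, then the class number
of `ℚ(p^{1/4})`, i.e. of any number field generated over `ℚ` by an element `α` with `α ^ 4 = p`,
is congruent to `2` modulo `4`. -/
theorem classNumber_mod_four_eq_two_of_prime_mod_sixteen_eq_nine
    (p : ℕ) (hp : p.Prime) (hp16 : p % 16 = 9)
    (K : Type) [Field K] [NumberField K] (α : K)
    (hα : α ^ 4 = (p : K)) (hgen : Algebra.adjoin ℚ {α} = ⊤) :
    NumberField.classNumber K % 4 = 2 := by
  have : Fact p.Prime := ⟨hp⟩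
  obtain ⟨T⟩ := QuarticTower.exists_of_pow_four_eq hp hp16 hα hgen
  exact T.classNumber_mod_four hp16
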